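/- Let N ≥ 1, p > 1, m ≥ 1, q > max(p+m−2, 1), and let f, a be as in the setting, with V ≡ 1. Suppose there exists C > 0 such that for all sufficiently large R one has μ_a(B_R) ≤ C R^{p/(q−p−m+2)} (log R)^{δ}, where δ = min(1/(q−1), (p+m−2)/(q−p−m+2)). Then every global nonnegative weak solution of ∂_t u ≥ (1/a) div(a u^{m−1} |∇u|^{p−2} f(|∇u|) ∇u) + u^q on S is zero a.e. (Euclidean specialization of the paper's Corollary 1.12.) -/

import Mathlib

open MeasureTheory Real Set Metric
open scoped ENNReal RealInnerProductSpace

noncomputable section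

/-- Euclidean space `ℝ^N`. -/
abbrev Euc (N : ℕ) : Type := EuclideanSpace ℝ (Fin N)

/-- The parabolic slab `S = ℝ^N × (0,∞)`. -/
def Sset (N : ℕ) : Set (Euc N × ℝ) := {z : Euc N × ℝ | 0 < z.2}

/-- The weighted measure `μ_a = a(x) dx` on `ℝ^N`. -/
def muA {N : ℕ} (a : Euc N → ℝ) : Measure (Euc N) :=
  (volume : Measure (Euc N)).withDensity (fun x => ENNReal.ofReal (a x))

/-- The measure `dμ_a dt` on `ℝ^N × (0,∞)`. -/
def muS {N : ℕ} (a : Euc N → ℝ) : Measure (Euc N × ℝ) :=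
  (muA a).prod ((volume : Measure ℝ).restrict (Set.Ioi (0 : ℝ)))

/-- The continuous linear functional `(w, τ) ↦ ⟪v, w⟫ + c·τ` on `ℝ^N × ℝ`,
encoding a space-time differential with spatial gradient `v` and time derivative `c`. -/
def pairCLM {N : ℕ} (v : Euc N) (c : ℝ) : (Euc N × ℝ) →L[ℝ] ℝ :=
  ((innerSL ℝ v).comp (ContinuousLinearMap.fst ℝ (Euc N) ℝ)) +
    c • (ContinuousLinearMap.snd ℝ (Euc N) ℝ)

/-- `u` is a global nonnegative weak solution of
`∂ₜ u ≥ (1/a) div(a u^{m-1} |∇u|^{p-2} f(|∇u|) ∇u) + V u^q` on `S = ℝ^N × (0,∞)`,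
where `gu`, `ut` are a.e. representatives of the spatial gradient and the time
derivative of `u`. -/
structure IsWeakSol (N : ℕ) (p m q : ℝ) (V : Euc N × ℝ → ℝ) (f : ℝ → ℝ)
    (a : Euc N → ℝ) (u : Euc N × ℝ → ℝ) (gu : Euc N × ℝ → Euc N)
    (ut : Euc N × ℝ → ℝ) : Prop where
  nonneg : ∀ z ∈ Sset N, 0 ≤ u z
  locLip : LocallyLipschitzOn (Sset N) u
  deriv_ae : ∀ᵐ z ∂ ((volume : Measure (Euc N × ℝ)).restrict (Sset N)),
      DifferentiableAt ℝ u z → HasFDerivAt u (pairCLM (gu z) (ut z)) z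
  int_uqV : LocallyIntegrableOn (fun z => u z ^ q * V z) (Sset N) (muS a)
  int_upm : LocallyIntegrableOn (fun z => u z ^ (p + m - 1)) (Sset N) (muS a)
  int_gu : LocallyIntegrableOn (fun z => ‖gu z‖ ^ p * u z ^ (m - 1)) (Sset N) (muS a)
  int_ut : LocallyIntegrableOn (fun z => u z * ut z) (Sset N) (muS a)
  weak_ineq : ∀ (ψ : Euc N × ℝ → ℝ) (gψ : Euc N × ℝ → Euc N) (tψ : Euc N × ℝ → ℝ),
      (∀ z, 0 ≤ ψ z) → LocallyLipschitz ψ → HasCompactSupport ψ →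
      tsupport ψ ⊆ Sset N →
      (∀ᵐ z ∂ (volume : Measure (Euc N × ℝ)),
        DifferentiableAt ℝ ψ z → HasFDerivAt ψ (pairCLM (gψ z) (tψ z)) z) →
      ∫ z, ψ z * u z ^ q * V z ∂ muS a ≤
        (∫ z, ⟪gψ z, gu z⟫ * u z ^ (m - 1) * ‖gu z‖ ^ (p - 2) * f ‖gu z‖ ∂ muS a)
          - ∫ z, tψ z * u z ∂ muS a

/-- The region `E_R = {(x,t) ∈ S : |x|^θ2 + t^θ1 ≤ R^θ2}`. -/
def ESet (N : ℕ) (θ1 θ2 R : ℝ) : Set (Euc N × ℝ) :=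
  {z ∈ Sset N | ‖z.1‖ ^ θ2 + z.2 ^ θ1 ≤ R ^ θ2}

/-- The time cutoff `χ_β`. -/
def chi (β t : ℝ) : ℝ := min 1 (max 0 (t / β - 1))

open Filter Topology
open scoped NNReal

section

theorem mul_rpow_sub_one_le {p X Y g : ℝ} (hp : 1 < p) (hX : 0 ≤ X) (hY : 0 < Y) (hg : 0 ≤ g) :
    X * g ^ (p - 1) ≤ Y * g ^ p + X ^ p * Y ^ (1 - p) := by
  have hgp : 0 ≤ g ^ p := rpow_nonneg hg _
  have hgp1 : 0 ≤ g ^ (p - 1) := rpow_nonneg hg _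
  have h2 : 0 ≤ X ^ p * Y ^ (1 - p) := by positivity
  rcases le_total X (Y * g) with h | h
  · have : g * g ^ (p - 1) = g ^ p := by
      rcases hg.eq_or_lt with rfl | hg
      · rw [zero_mul, zero_rpow (by linarith)]
      · rw [← rpow_one_add' hg.le (by linarith)]; congr 1; ring
    calc X * g ^ (p - 1) ≤ Y * g * g ^ (p - 1) := by gcongr
      _ = Y * g ^ p := by rw [mul_assoc, this]
      _ ≤ _ := by linarith
  · have hgX : g ≤ X / Y := by rw [le_div_iff₀ hY]; linarith
    calc X * g ^ (p - 1) ≤ X * (X / Y) ^ (p - 1) := by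
          gcongr
      _ = X ^ p * Y ^ (1 - p) := by
          rw [div_rpow hX hY.le, div_eq_mul_inv, ← rpow_neg hY.le, ← mul_assoc,
            ← rpow_one_add' hX (by linarith)]
          congr 2 <;> ring
      _ ≤ _ := by nlinarith [mul_nonneg hY.le hgp]

theorem mul_rpow_le_add_rpow {q x B Λ v : ℝ} (hx : 0 < x) (hxq : x < q) (hB : 0 ≤ B)
    (hΛ : 0 < Λ) (hv : 0 ≤ v) :
    B * v ^ x ≤ Λ * v ^ q + Λ ^ (-(x / (q - x))) * B ^ (q / (q - x)) := by
  have hqx : 0 < q - x := by linarith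
  have h1 : 0 ≤ Λ * v ^ q := by positivity
  have h2 : 0 ≤ Λ ^ (-(x / (q - x))) * B ^ (q / (q - x)) := by positivity
  rcases le_total B (Λ * v ^ (q - x)) with h | h
  · have : v ^ (q - x) * v ^ x = v ^ q := by
      rw [← rpow_add' hv (by linarith)]; congr 1; ring
    calc B * v ^ x ≤ Λ * v ^ (q - x) * v ^ x := by gcongr
      _ = Λ * v ^ q := by rw [mul_assoc, this]
      _ ≤ _ := by linarith
  · have hvB : v ≤ (B / Λ) ^ (1 / (q - x)) := by
      have : v ^ (q - x) ≤ B / Λ := by rw [le_div_iff₀ hΛ]; linarith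
      calc v = (v ^ (q - x)) ^ (1 / (q - x)) := by
            rw [← rpow_mul hv, mul_one_div_cancel hqx.ne', rpow_one]
        _ ≤ _ := by gcongr
    calc B * v ^ x ≤ B * ((B / Λ) ^ (1 / (q - x))) ^ x := by gcongr
      _ = Λ ^ (-(x / (q - x))) * B ^ (q / (q - x)) := by
          rw [← rpow_mul (by positivity), div_rpow hB hΛ.le, div_eq_mul_inv, ← rpow_neg hΛ.le,
            ← mul_assoc, ← rpow_one_add' hB (by positivity), mul_comm]
          congr 2 <;> field_simp
          ring
      _ ≤ _ := by linarith

theorem weighted_young {n η y s p q x k l D Λ v : ℝ} (hn : 1 ≤ n) (hη : 0 < η) (hη1 : η ≤ 1)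
    (hx : 0 < x) (hxq : x < q) (hD : D ≤ y * (q / (q - x))) (hs : p * (q / (q - x)) ≤ s)
    (hΛ : 0 < Λ) (hv : 0 ≤ v) :
    n ^ (-y) * η ^ (s - p) * exp (-(k * (q - x) * l)) * v ^ x ≤
      Λ * (η ^ s * v ^ q) + Λ ^ (-(x / (q - x))) * (n ^ (-D) * exp (-(k * q * l))) := by
  have hqx : 0 < q - x := by linarith
  have hn0 : 0 < n := by linarith
  refine (mul_rpow_le_add_rpow (Λ := Λ * η ^ s) hx hxq (by positivity) (by positivity) hv).trans ?_
  rw [mul_assoc Λ]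
  gcongr ?_ + ?_
  · exact le_rfl
  have e : (Λ * η ^ s) ^ (-(x / (q - x))) *
      (n ^ (-y) * η ^ (s - p) * exp (-(k * (q - x) * l))) ^ (q / (q - x)) =
      Λ ^ (-(x / (q - x))) * (n ^ (-(y * (q / (q - x)))) * η ^ (s - p * (q / (q - x))) *
        exp (-(k * q * l))) := by
    rw [mul_rpow hΛ.le (by positivity), mul_rpow (by positivity) (by positivity),
      mul_rpow (by positivity) (by positivity), ← rpow_mul hη.le, ← rpow_mul hη.le,
      ← rpow_mul hn0.le, ← Real.exp_mul]
    have : η ^ (s - p * (q / (q - x))) =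
        η ^ (s * -(x / (q - x))) * η ^ ((s - p) * (q / (q - x))) := by
      rw [← rpow_add hη]; congr 1; field_simp; ring
    rw [this]
    have : -(k * (q - x) * l) * (q / (q - x)) = -(k * q * l) := by field_simp
    rw [this, neg_mul]
    ring
  rw [e]
  have h1 : n ^ (-(y * (q / (q - x)))) ≤ n ^ (-D) := rpow_le_rpow_of_exponent_le hn (by linarith)
  have h2 : η ^ (s - p * (q / (q - x))) ≤ 1 := rpow_le_one hη.le hη1 (by linarith)
  gcongr
  calc _ ≤ n ^ (-D) * 1 := by gcongr
    _ = _ := mul_one _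

end

section

theorem young_remainder_cutoff {s n η l v α p m b c : ℝ} (hs : 0 < s) (hn : 0 < n) (hη : 0 < η)
    (hv : 0 < v) (hα : 0 < α) :
    (s / n * η ^ (s - 1) * exp (-l)) ^ p *
        (α / 2 * (n ^ (-(1 + b)) * exp (-(c * l)) * η ^ s * v ^ (-α - 1))) ^ (1 - p) * v ^ (m - 1) =
      s ^ p * (α / 2) ^ (1 - p) * (n ^ (-(1 - b * (p - 1))) * η ^ (s - p) *
        exp (-((p - c * (p - 1)) * l)) * v ^ (p + m - 2 + α * (p - 1))) := by
  have hα2 : 0 < α / 2 := by positivity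
  generalize α / 2 = A at *
  obtain ⟨A, rfl⟩ : ∃ x, exp x = A := ⟨_, exp_log hα2⟩
  obtain ⟨n, rfl⟩ : ∃ x, exp x = n := ⟨_, exp_log hn⟩
  obtain ⟨η, rfl⟩ : ∃ x, exp x = η := ⟨_, exp_log hη⟩
  obtain ⟨v, rfl⟩ : ∃ x, exp x = v := ⟨_, exp_log hv⟩
  obtain ⟨S, hS⟩ : ∃ x, exp x = s := ⟨_, exp_log hs⟩
  rw [div_mul_eq_mul_div, div_mul_eq_mul_div, div_eq_mul_inv, ← hS]
  simp only [← Real.exp_mul, ← Real.exp_add, ← Real.exp_neg]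
  congr 1; ring

theorem young_remainder_weight {s n η l v α p m b c : ℝ} (hs : 0 < s) (hc : 0 ≤ c) (hn : 0 < n)
    (hη : 0 < η) (hv : 0 < v) (hα : 0 < α) :
    (n ^ (-(1 + b)) * (c + s) * exp (-(c * l)) * exp (-l) * η ^ (s - 1) * v ^ (-α)) ^ p *
        (α / 2 * (n ^ (-(1 + b)) * exp (-(c * l)) * η ^ s * v ^ (-α - 1))) ^ (1 - p) * v ^ (m - 1) =
      (c + s) ^ p * (α / 2) ^ (1 - p) * (n ^ (-(1 + b)) * η ^ (s - p) *
        exp (-((c + p) * l)) * v ^ (p + m - 2 - α)) := by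
  have hα2 : 0 < α / 2 := by positivity
  have hcs : 0 < c + s := by positivity
  generalize α / 2 = A at *
  generalize c + s = d at *
  obtain ⟨A, rfl⟩ : ∃ x, exp x = A := ⟨_, exp_log hα2⟩
  obtain ⟨n, rfl⟩ : ∃ x, exp x = n := ⟨_, exp_log hn⟩
  obtain ⟨η, rfl⟩ : ∃ x, exp x = η := ⟨_, exp_log hη⟩
  obtain ⟨v, rfl⟩ : ∃ x, exp x = v := ⟨_, exp_log hv⟩
  obtain ⟨d, rfl⟩ : ∃ x, exp x = d := ⟨_, exp_log hcs⟩
  simp only [← Real.exp_mul, ← Real.exp_add]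
  congr 1; ring

/-- Parameters of the test functions: `α` is the power of the solution used in the test
function, `s` the power of the cutoff, `δ` the logarithmic volume growth exponent. -/
structure Params (p m q α s δ : ℝ) : Prop where
  hp : 1 < p
  hm : 1 ≤ m
  hq : 1 < q
  hσ : 0 < q - p - m + 2
  hα : 0 < α
  hα1 : α < 1
  hαp : α < p - 1
  hασ : α * (p - 1) < q - p - m + 2
  hs1 : 1 < s
  hs : ∀ x, x ≤ 1 ∨ x ≤ p + m - 2 + α * (p - 1) → p * (q / (q - x)) ≤ s
  hδ1 : δ ≤ 1 / (q - 1)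
  hδ2 : δ ≤ (p + m - 2) / (q - p - m + 2)

theorem exists_params {p m q : ℝ} (hp : 1 < p) (hm : 1 ≤ m) (hq : max (p + m - 2) 1 < q) :
    ∃ α s, Params p m q α s (min (1 / (q - 1)) ((p + m - 2) / (q - p - m + 2))) := by
  obtain ⟨h1, h2⟩ := max_lt_iff.1 hq
  have hσ : 0 < q - p - m + 2 := by linarith
  obtain ⟨α, hα, hα'⟩ := exists_between
    (show (0 : ℝ) < min (min 1 (p - 1)) ((q - p - m + 2) / (p - 1)) by
      have : 0 < p - 1 := by linarith
      positivity)
  simp only [lt_min_iff] at hα'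
  obtain ⟨⟨hα1, hαp⟩, hα2⟩ := hα'
  rw [lt_div_iff₀ (by linarith)] at hα2
  refine ⟨α, max 2 (max (p * (q / (q - 1)))
    (p * (q / (q - (p + m - 2 + α * (p - 1)))))), hp, hm, h2, hσ, hα, hα1, hαp, hα2, ?_, ?_,
    min_le_left _ _, min_le_right _ _⟩
  · exact lt_of_lt_of_le (by norm_num) (le_max_left _ _)
  · rintro x (hx | hx)
    · refine le_trans ?_ ((le_max_left _ _).trans (le_max_right _ _))
      have : 0 < q - 1 := by linarith
      gcongr
    · refine le_trans ?_ ((le_max_right _ _).trans (le_max_right _ _))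
      have : 0 < q - (p + m - 2 + α * (p - 1)) := by linarith
      gcongr

/-- The decaying factor in the final estimate. -/
def decay (p m q α Λ : ℝ) : ℝ :=
  Λ ^ (-((p + m - 2 + α * (p - 1)) / (q - (p + m - 2 + α * (p - 1))))) +
  Λ ^ (-((p + m - 2 - α) / (q - (p + m - 2 - α)))) + Λ ^ (-(1 / (q - 1))) +
  Λ ^ (-((1 - α) / (q - (1 - α))))

variable {p m q α s δ : ℝ}

theorem decay_nonneg {Λ : ℝ} (hΛ : 0 < Λ) : 0 ≤ decay p m q α Λ := by
  unfold decay; positivity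

theorem tendsto_decay (P : Params p m q α s δ) : Tendsto (decay p m q α) atTop (𝓝 0) := by
  obtain ⟨hp, hm, hq, hσ, hα, hα1, hαp, hασ, hs1, hs, hδ1, hδ2⟩ := P
  have h0 : 0 < α * (p - 1) := mul_pos hα (by linarith)
  have := (((tendsto_rpow_neg_atTop
    (show 0 < (p + m - 2 + α * (p - 1)) / (q - (p + m - 2 + α * (p - 1))) from
      div_pos (by linarith) (by linarith))).add (tendsto_rpow_neg_atTop
    (show 0 < (p + m - 2 - α) / (q - (p + m - 2 - α)) from
      div_pos (by linarith) (by linarith)))).add (tendsto_rpow_neg_atTop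
    (show 0 < 1 / (q - 1) from
      div_pos (by linarith) (by linarith)))).add (tendsto_rpow_neg_atTop
    (show 0 < (1 - α) / (q - (1 - α)) from
      div_pos (by linarith) (by linarith)))
  simp only [add_zero] at this
  exact this

/-- The integrand bounding both the elliptic and the parabolic remainder. -/
def remainder (p m q α s δ Λ n η v : ℝ) : ℝ :=
  Λ * (η ^ s * v ^ q) + decay p m q α Λ * (n ^ (-(1 + δ)) *
    exp (-(p / (q - p - m + 2) * q * (n * (2 - η)))))

theorem remainder_nonneg {Λ n η v : ℝ} (hn : 0 ≤ n) (hη : 0 ≤ η) (hv : 0 ≤ v) (hΛ : 0 < Λ) :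
    0 ≤ remainder p m q α s δ Λ n η v := by
  have := decay_nonneg (p := p) (m := m) (q := q) (α := α) hΛ
  unfold remainder; positivity

/-- The weight multiplying the power of the solution in the test function. -/
def wt (p m q α s n η : ℝ) : ℝ :=
  n ^ (-(1 + α / (q - p - m + 2))) *
    exp (-(p * α / (q - p - m + 2) * (n * (2 - η)))) * η ^ s

def wt' (p m q α s n η : ℝ) : ℝ :=
  n ^ (-(1 + α / (q - p - m + 2))) *
    exp (-(p * α / (q - p - m + 2) * (n * (2 - η)))) *
    (p * α / (q - p - m + 2) * n * η ^ s + s * η ^ (s - 1))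

theorem hasDerivAt_wt (hs : 1 < s) (n η : ℝ) :
    HasDerivAt (wt p m q α s n) (wt' p m q α s n η) η := by
  unfold wt wt'
  have h1 : HasDerivAt (fun η : ℝ => η ^ s) (s * η ^ (s - 1)) η :=
    hasDerivAt_rpow_const (Or.inr hs.le)
  have h2 : HasDerivAt (fun η : ℝ => -(p * α / (q - p - m + 2) * (n * (2 - η))))
      (p * α / (q - p - m + 2) * n) η := by
    have := ((((hasDerivAt_id η).const_sub 2).const_mul n).const_mul
      (p * α / (q - p - m + 2))).neg
    exact this.congr_deriv (by simp)
  exact ((h2.exp.const_mul (n ^ (-(1 + α / (q - p - m + 2))))).mul h1).congr_deriv (by ring)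

theorem wt_nonneg {n η : ℝ} (hn : 0 ≤ n) (hη : 0 ≤ η) : 0 ≤ wt p m q α s n η := by
  unfold wt; positivity

theorem wt'_le (P : Params p m q α s δ) {n η : ℝ} (hn : 1 ≤ n) (hη : 0 < η) (hη1 : η ≤ 1) :
    wt' p m q α s n η / n ≤ n ^ (-(1 + α / (q - p - m + 2))) *
      (p * α / (q - p - m + 2) + s) *
      exp (-(p * α / (q - p - m + 2) * (n * (2 - η)))) * η ^ (s - 1) := by
  obtain ⟨hp, hm, hq, hσ, hα, hα1, hαp, hασ, hs1, hs, hδ1, hδ2⟩ := P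
  have hn0 : 0 < n := by linarith
  have hs0 : 0 < s := by linarith
  have hc : 0 ≤ p * α / (q - p - m + 2) := by positivity
  unfold wt'
  rw [mul_div_assoc]
  have : (p * α / (q - p - m + 2) * n * η ^ s + s * η ^ (s - 1)) / n ≤
      (p * α / (q - p - m + 2) + s) * η ^ (s - 1) := by
    rw [div_le_iff₀ hn0]
    have h1 : η ^ s ≤ η ^ (s - 1) := rpow_le_rpow_of_exponent_ge hη hη1 (by linarith)
    have h2 : 0 < η ^ (s - 1) := by positivity
    have h3 : s * η ^ (s - 1) ≤ s * η ^ (s - 1) * n := le_mul_of_one_le_right (by positivity) hn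
    have h4 := mul_le_mul_of_nonneg_left h1 (mul_nonneg hc hn0.le)
    nlinarith
  calc _ ≤ n ^ (-(1 + α / (q - p - m + 2))) *
      exp (-(p * α / (q - p - m + 2) * (n * (2 - η)))) *
      ((p * α / (q - p - m + 2) + s) * η ^ (s - 1)) := by gcongr
    _ = _ := by ring

theorem wt'_nonneg (P : Params p m q α s δ) {n η : ℝ} (hn : 1 ≤ n) (hη : 0 ≤ η) :
    0 ≤ wt' p m q α s n η := by
  obtain ⟨hp, hm, hq, hσ, hα, hα1, hαp, hασ, hs1, hs, hδ1, hδ2⟩ := P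
  unfold wt'
  positivity

theorem elliptic_young (P : Params p m q α s δ) {n η l v Λ : ℝ} (hn : 1 ≤ n) (hη : 0 < η)
    (hη1 : η ≤ 1) (hv : 0 < v) (hΛ : 0 < Λ) (hl : l = n * (2 - η)) :
    n ^ (-(1 - α / (q - p - m + 2) * (p - 1))) * η ^ (s - p) *
        exp (-((p - p * α / (q - p - m + 2) * (p - 1)) * l)) * v ^ (p + m - 2 + α * (p - 1)) ≤
      remainder p m q α s δ Λ n η v ∧
    n ^ (-(1 + α / (q - p - m + 2))) * η ^ (s - p) *
        exp (-((p * α / (q - p - m + 2) + p) * l)) * v ^ (p + m - 2 - α) ≤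
      remainder p m q α s δ Λ n η v ∧
    n ^ (-(1 : ℝ)) * η ^ (s - p) * exp (-(p / (q - p - m + 2) * (q - 1) * l)) * v ^ (1 : ℝ) ≤
      remainder p m q α s δ Λ n η v ∧
    n ^ (-(1 + α / (q - p - m + 2))) * η ^ (s - p) *
        exp (-(p / (q - p - m + 2) * (q - (1 - α)) * l)) * v ^ (1 - α) ≤
      remainder p m q α s δ Λ n η v := by
  obtain ⟨hp, hm, hq, hσ, hα, hα1, hαp, hασ, hs1, hs, hδ1, hδ2⟩ := P
  have h0 : 0 < α * (p - 1) := mul_pos hα (by linarith)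
  have hn0 : 0 < n := by linarith
  have hq1 : 0 < q - 1 := by linarith
  have hL : 1 + (p + m - 2) / (q - p - m + 2) = q / (q - p - m + 2) := by field_simp; ring
  have hT : 1 + 1 / (q - 1) = q / (q - 1) := by field_simp; ring
  have hE : 0 ≤ n ^ (-(1 + δ)) * exp (-(p / (q - p - m + 2) * q * l)) := by positivity
  have key : ∀ x y k, 0 < x → x < q → 1 + δ ≤ y * (q / (q - x)) →
      (x ≤ 1 ∨ x ≤ p + m - 2 + α * (p - 1)) → k = p / (q - p - m + 2) * (q - x) →
      Λ ^ (-(x / (q - x))) ≤ decay p m q α Λ →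
      n ^ (-y) * η ^ (s - p) * exp (-(k * l)) * v ^ x ≤ remainder p m q α s δ Λ n η v := by
    intro x y k hx hxq hy hxs hk hd
    rw [hk]
    refine (weighted_young hn hη hη1 hx hxq hy (hs x hxs) hΛ hv.le).trans ?_
    unfold remainder
    rw [← hl]
    gcongr
  have d1 : 0 ≤ Λ ^ (-((p + m - 2 + α * (p - 1)) / (q - (p + m - 2 + α * (p - 1))))) := by
    positivity
  have d2 : 0 ≤ Λ ^ (-((p + m - 2 - α) / (q - (p + m - 2 - α)))) := by positivity
  have d3 : 0 ≤ Λ ^ (-(1 / (q - 1))) := by positivity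
  have d4 : 0 ≤ Λ ^ (-((1 - α) / (q - (1 - α)))) := by positivity
  refine ⟨key _ _ _ (by linarith) (by linarith) ?_ (Or.inr le_rfl) ?_ ?_,
    key _ _ _ (by linarith) (by linarith) ?_ (Or.inr (by linarith)) ?_ ?_,
    key _ _ _ (by linarith) (by linarith) ?_ (Or.inl le_rfl) ?_ ?_,
    key _ _ _ (by linarith) (by linarith) ?_ (Or.inl (by linarith)) ?_ ?_⟩
  · have : q - (p + m - 2 + α * (p - 1)) ≠ 0 := by linarith
    have : (1 - α / (q - p - m + 2) * (p - 1)) * (q / (q - (p + m - 2 + α * (p - 1)))) =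
        q / (q - p - m + 2) := by
      field_simp; ring
    linarith
  · field_simp; ring
  · unfold decay; linarith
  · have h : q - (p + m - 2 - α) ≠ 0 := by linarith
    have : (1 + α / (q - p - m + 2)) * (q / (q - (p + m - 2 - α))) =
        q / (q - p - m + 2) := by
      field_simp; ring
    linarith
  · field_simp; ring
  · unfold decay; linarith
  · rw [one_mul]; linarith
  · rfl
  · unfold decay; linarith
  · have h : 0 < q - (1 - α) := by linarith
    rcases le_total (q - p - m + 2) (q - 1) with h' | h'
    · have : q / (q - 1) ≤ (1 + α / (q - p - m + 2)) * (q / (q - (1 - α))) := by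
        rw [← sub_nonneg]
        have : (1 + α / (q - p - m + 2)) * (q / (q - (1 - α))) - q / (q - 1) =
          q * α * ((q - 1) - (q - p - m + 2)) / ((q - p - m + 2) * (q - (1 - α)) * (q - 1)) := by
          field_simp; ring
        rw [this]
        apply div_nonneg _ (by positivity)
        apply mul_nonneg (by positivity); linarith
      linarith
    · have : q / (q - p - m + 2) ≤ (1 + α / (q - p - m + 2)) * (q / (q - (1 - α))) := by
        rw [← sub_nonneg]
        have : (1 + α / (q - p - m + 2)) * (q / (q - (1 - α))) - q / (q - p - m + 2) =
          q * ((q - p - m + 2) - (q - 1)) / ((q - p - m + 2) * (q - (1 - α))) := by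
          field_simp; ring
        rw [this]
        apply div_nonneg _ (by positivity)
        apply mul_nonneg (by positivity); linarith
      linarith
  · rfl
  · unfold decay; linarith

end

section

variable {p m q α s δ : ℝ}

theorem exists_elliptic_bound (P : Params p m q α s δ) {K : ℝ} (hK : 0 < K) :
    ∃ C, 0 < C ∧ ∀ n η v u g f e Λ : ℝ, 1 ≤ n → 0 < η → η ≤ 1 → 0 < v → 0 ≤ u → u ≤ v → 0 ≤ g →
      0 ≤ f → f ≤ K → 0 < Λ → |e| ≤ exp (-(n * (2 - η))) / n * g →
      ((s * η ^ (s - 1) + wt' p m q α s n η * v ^ (-α)) * e -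
        α * wt p m q α s n η * v ^ (-α - 1) * g ^ 2) * u ^ (m - 1) * g ^ (p - 2) * f ≤
        C * remainder p m q α s δ Λ n η v := by
  have P' := P
  obtain ⟨hp, hm, hq, hσ, hα, hα1, hαp, hασ, hs1, hs, hδ1, hδ2⟩ := P
  have hs0 : 0 < s := by linarith
  have hc : 0 ≤ p * α / (q - p - m + 2) := by positivity
  set c := p * α / (q - p - m + 2) with hc_def
  set b := α / (q - p - m + 2) with hb_def
  refine ⟨K * (s ^ p * (α / 2) ^ (1 - p) + (c + s) ^ p * (α / 2) ^ (1 - p)), by positivity, ?_⟩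
  intro n η v u g f e Λ hn hη hη1 hv hu huv hg hf hfK hΛ he
  have hn0 : 0 < n := by linarith
  have hR := remainder_nonneg (p := p) (m := m) (q := q) (α := α) (s := s) (δ := δ)
    hn0.le hη.le hv.le hΛ
  rcases hg.eq_or_lt with rfl | hg0
  · have : e = 0 := by simpa using he
    subst this
    simp only [mul_zero, ne_eq, OfNat.ofNat_ne_zero, not_false_eq_true, zero_pow,
      sub_self, zero_mul]
    positivity
  obtain ⟨l, hl⟩ : ∃ l, l = n * (2 - η) := ⟨_, rfl⟩
  rw [← hl] at he
  obtain ⟨r0, r1, -, -⟩ := elliptic_young P' hn hη hη1 hv hΛ hl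
  have hW : wt p m q α s n η = n ^ (-(1 + b)) * exp (-(c * l)) * η ^ s := by rw [hl]; rfl
  have hW' := wt'_le P' hn hη hη1
  rw [← hl, ← hc_def, ← hb_def] at hW'
  have hW'0 := wt'_nonneg P' hn hη.le
  have hv1 : 0 < v ^ (-α) := by positivity
  set X0 := s / n * η ^ (s - 1) * exp (-l) with hX0
  set X1 := n ^ (-(1 + b)) * (c + s) * exp (-(c * l)) * exp (-l) * η ^ (s - 1) * v ^ (-α) with hX1
  set Y := α / 2 * (n ^ (-(1 + b)) * exp (-(c * l)) * η ^ s * v ^ (-α - 1)) with hY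
  have hX0' : 0 ≤ X0 := by positivity
  have hX1' : 0 ≤ X1 := by positivity
  have hY' : 0 < Y := by positivity
  have q0 := mul_rpow_sub_one_le hp hX0' hY' hg
  have q1 := mul_rpow_sub_one_le hp hX1' hY' hg
  have hT : (s * η ^ (s - 1) + wt' p m q α s n η * v ^ (-α)) * e ≤ (X0 + X1) * g := by
    calc _ ≤ (s * η ^ (s - 1) + wt' p m q α s n η * v ^ (-α)) * (exp (-l) / n * g) := by
          apply mul_le_mul_of_nonneg_left ((le_abs_self e).trans he); positivity
      _ = X0 * g + wt' p m q α s n η / n * (v ^ (-α) * exp (-l) * g) := by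
          rw [hX0]; field_simp
      _ ≤ X0 * g + n ^ (-(1 + b)) * (c + s) * exp (-(c * l)) * η ^ (s - 1) *
            (v ^ (-α) * exp (-l) * g) := by gcongr
      _ = _ := by rw [hX1]; ring
  have hYW : α * wt p m q α s n η * v ^ (-α - 1) = 2 * Y := by rw [hW, hY]; ring
  have hg1 : g * g ^ (p - 2) = g ^ (p - 1) := by
    rw [← rpow_one_add' hg (by linarith)]; congr 1; ring
  have hg2 : g ^ 2 * g ^ (p - 2) = g ^ p := by
    rw [← rpow_natCast, ← rpow_add hg0]; congr 1; push_cast; ring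
  have hgp : 0 < g ^ (p - 2) := by positivity
  have hbr : ((s * η ^ (s - 1) + wt' p m q α s n η * v ^ (-α)) * e -
        α * wt p m q α s n η * v ^ (-α - 1) * g ^ 2) * g ^ (p - 2) ≤
        X0 ^ p * Y ^ (1 - p) + X1 ^ p * Y ^ (1 - p) := by
    rw [hYW]
    calc _ ≤ ((X0 + X1) * g - 2 * Y * g ^ 2) * g ^ (p - 2) := by gcongr
      _ = (X0 + X1) * (g * g ^ (p - 2)) - 2 * Y * (g ^ 2 * g ^ (p - 2)) := by ring
      _ ≤ _ := by rw [hg1, hg2]; linarith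
  have hum : u ^ (m - 1) ≤ v ^ (m - 1) := rpow_le_rpow hu huv (by linarith)
  have hum0 : 0 ≤ u ^ (m - 1) := by positivity
  have e0 := young_remainder_cutoff (p := p) (m := m) (b := b) (c := c) (l := l)
    hs0 hn0 hη hv hα
  have e1 := young_remainder_weight (p := p) (m := m) (b := b) (l := l) hs0 hc hn0 hη hv hα
  rw [← hX0, ← hY] at e0
  rw [← hX1, ← hY] at e1
  have hXY : 0 ≤ X0 ^ p * Y ^ (1 - p) + X1 ^ p * Y ^ (1 - p) := by positivity
  calc _ = ((s * η ^ (s - 1) + wt' p m q α s n η * v ^ (-α)) * e -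
        α * wt p m q α s n η * v ^ (-α - 1) * g ^ 2) * g ^ (p - 2) * (u ^ (m - 1) * f) := by ring
    _ ≤ (X0 ^ p * Y ^ (1 - p) + X1 ^ p * Y ^ (1 - p)) * (u ^ (m - 1) * f) := by gcongr
    _ ≤ (X0 ^ p * Y ^ (1 - p) + X1 ^ p * Y ^ (1 - p)) * (v ^ (m - 1) * K) := by gcongr
    _ = K * (X0 ^ p * Y ^ (1 - p) * v ^ (m - 1) + X1 ^ p * Y ^ (1 - p) * v ^ (m - 1)) := by ring
    _ ≤ K * (s ^ p * (α / 2) ^ (1 - p) * remainder p m q α s δ Λ n η v +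
        (c + s) ^ p * (α / 2) ^ (1 - p) * remainder p m q α s δ Λ n η v) := by
      rw [e0, e1]; gcongr
    _ = _ := by ring

theorem exists_parabolic_bound (P : Params p m q α s δ) :
    ∃ C, 0 < C ∧ ∀ n η v u F e Λ : ℝ, 1 ≤ n → 0 < η → η ≤ 1 → 0 < v → 0 ≤ u → u ≤ v → 0 ≤ F →
      F ≤ v ^ (1 - α) / (1 - α) → 0 < Λ →
      |e| ≤ exp (-(p / (q - p - m + 2) * (q - 1) * (n * (2 - η)))) /
        (p / (q - p - m + 2) * (q - 1)) / n →
      -((s * η ^ (s - 1) * u + wt' p m q α s n η * F) * e) ≤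
        C * remainder p m q α s δ Λ n η v := by
  have P' := P
  obtain ⟨hp, hm, hq, hσ, hα, hα1, hαp, hασ, hs1, hs, hδ1, hδ2⟩ := P
  have hs0 : 0 < s := by linarith
  have hq1 : 0 < q - 1 := by linarith
  have ha1 : 0 < 1 - α := by linarith
  have hc : 0 ≤ p * α / (q - p - m + 2) := by positivity
  set c := p * α / (q - p - m + 2) with hc_def
  set b := α / (q - p - m + 2) with hb_def
  set γ := p / (q - p - m + 2) * (q - 1) with hγ_def
  have hγ : 0 < γ := by positivity
  refine ⟨(s + (c + s) / (1 - α)) / γ, by positivity, ?_⟩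
  intro n η v u F e Λ hn hη hη1 hv hu huv hF hFv hΛ he
  have hn0 : 0 < n := by linarith
  obtain ⟨l, hl⟩ : ∃ l, l = n * (2 - η) := ⟨_, rfl⟩
  rw [← hl] at he
  obtain ⟨-, -, r0, r1⟩ := elliptic_young P' hn hη hη1 hv hΛ hl
  rw [← hγ_def] at r0
  have hW' := wt'_le P' hn hη hη1
  rw [← hl, ← hc_def, ← hb_def] at hW'
  have hW'0 := wt'_nonneg P' hn hη.le
  have hηs : η ^ (s - 1) ≤ η ^ (s - p) := rpow_le_rpow_of_exponent_ge hη hη1 (by linarith)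
  have hexp : exp (-(c * l)) * exp (-(γ * l)) =
      exp (-(p / (q - p - m + 2) * (q - (1 - α)) * l)) := by
    rw [← Real.exp_add]; congr 1; rw [hc_def, hγ_def]; field_simp; ring
  calc -((s * η ^ (s - 1) * u + wt' p m q α s n η * F) * e)
      = (s * η ^ (s - 1) * u + wt' p m q α s n η * F) * (-e) := by ring
    _ ≤ (s * η ^ (s - 1) * u + wt' p m q α s n η * F) * (exp (-(γ * l)) / γ / n) := by
        apply mul_le_mul_of_nonneg_left ((neg_le_abs e).trans he); positivity
    _ = (s * n⁻¹ * η ^ (s - 1) * exp (-(γ * l)) * u +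
          wt' p m q α s n η / n * exp (-(γ * l)) * F) / γ := by field_simp
    _ ≤ (s * n⁻¹ * η ^ (s - p) * exp (-(γ * l)) * v +
          n ^ (-(1 + b)) * (c + s) * exp (-(c * l)) * η ^ (s - p) * exp (-(γ * l)) *
            (v ^ (1 - α) / (1 - α))) / γ := by
        have : wt' p m q α s n η / n ≤
            n ^ (-(1 + b)) * (c + s) * exp (-(c * l)) * η ^ (s - p) :=
          hW'.trans (by gcongr)
        gcongr
    _ = (s * (n ^ (-(1 : ℝ)) * η ^ (s - p) * exp (-(γ * l)) * v ^ (1 : ℝ)) +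
          (c + s) / (1 - α) * (n ^ (-(1 + b)) * η ^ (s - p) *
            (exp (-(c * l)) * exp (-(γ * l))) * v ^ (1 - α))) / γ := by
        rw [rpow_neg_one, rpow_one]; field_simp
    _ ≤ (s * remainder p m q α s δ Λ n η v +
          (c + s) / (1 - α) * remainder p m q α s δ Λ n η v) / γ := by
        rw [hexp]; gcongr
    _ = _ := by ring

end

section

section LocallyLipschitz
variable {E F G : Type*} [NormedAddCommGroup E] [NormedAddCommGroup F] [NormedAddCommGroup G]

theorem LocallyLipschitzOn.contDiffAt_comp [NormedSpace ℝ F] [NormedSpace ℝ G] {f : E → F}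
    {g : F → G} {S : Set E}
    (hf : LocallyLipschitzOn S f) (hg : ∀ z ∈ S, ContDiffAt ℝ 1 g (f z)) :
    LocallyLipschitzOn S (fun z => g (f z)) := by
  intro z hz
  obtain ⟨K, t, ht, hK⟩ := hf hz
  obtain ⟨K', t', ht', hK'⟩ := (hg z hz).exists_lipschitzOnWith
  refine ⟨K' * K, t ∩ f ⁻¹' t', inter_mem ht ((hf.continuousOn z hz) ht'), ?_⟩
  exact hK'.comp (hK.mono inter_subset_left) (fun x hx => hx.2)

theorem LocallyLipschitzOn.prodMk' {f : E → F} {g : E → G} {S : Set E}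
    (hf : LocallyLipschitzOn S f) (hg : LocallyLipschitzOn S g) :
    LocallyLipschitzOn S (fun z => (f z, g z)) := by
  intro z hz
  obtain ⟨K, t, ht, hK⟩ := hf hz
  obtain ⟨K', t', ht', hK'⟩ := hg hz
  exact ⟨max K K', t ∩ t', inter_mem ht ht',
    (hK.mono inter_subset_left).prodMk (hK'.mono inter_subset_right)⟩

theorem ContDiffAt.locallyLipschitzOn' [NormedSpace ℝ E] [NormedSpace ℝ F] {f : E → F} {S : Set E}
    (hf : ∀ z ∈ S, ContDiffAt ℝ 1 f z) : LocallyLipschitzOn S f :=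
  LocallyLipschitz.id.locallyLipschitzOn.contDiffAt_comp hf

theorem LocallyLipschitzOn.locallyLipschitz_of_tsupport_subset {f : E → F} {S : Set E}
    (hf : LocallyLipschitzOn S f) (hS : IsOpen S) (hsupp : tsupport f ⊆ S) :
    LocallyLipschitz f := by
  intro z
  by_cases hz : z ∈ S
  · obtain ⟨K, t, ht, hK⟩ := hf hz
    exact ⟨K, t, by rwa [hS.nhdsWithin_eq hz] at ht, hK⟩
  · refine ⟨0, (tsupport f)ᶜ, (isClosed_tsupport f).isOpen_compl.mem_nhds
      (fun h => hz (hsupp h)), ?_⟩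
    intro x hx y hy
    simp [image_eq_zero_of_notMem_tsupport hx, image_eq_zero_of_notMem_tsupport hy]

theorem LocallyLipschitz.exists_lipschitzWith_of_hasCompactSupport [ProperSpace E] {f : E → F}
    (hf : LocallyLipschitz f) (hc : HasCompactSupport f) : ∃ C, LipschitzWith C f := by
  have hK : IsCompact (cthickening 1 (tsupport f)) := IsCompact.cthickening hc
  obtain ⟨C, hC⟩ := hf.locallyLipschitzOn.exists_lipschitzOnWith_of_compact
    (s := cthickening 1 (tsupport f)) hK
  obtain ⟨M, hM⟩ := hc.exists_bound_of_continuous hf.continuous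
  have hM0 : 0 ≤ M := (norm_nonneg _).trans (hM 0)
  have key : ∀ x y, x ∈ tsupport f → dist (f x) (f y) ≤ max C M.toNNReal * dist x y := by
    intro x y hx
    by_cases hy : y ∈ cthickening 1 (tsupport f)
    · refine (hC.dist_le_mul x (self_subset_cthickening _ hx) y hy).trans ?_
      gcongr; exact le_max_left _ _
    · have hxy : 1 ≤ dist x y := by
        by_contra! h
        exact hy (mem_cthickening_of_dist_le y x 1 _ hx (by rw [dist_comm]; exact h.le))
      have hfy : f y = 0 := image_eq_zero_of_notMem_tsupport
        (fun h => hy (self_subset_cthickening _ h))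
      rw [hfy, dist_zero_right]
      calc ‖f x‖ ≤ M := hM x
        _ ≤ (max C M.toNNReal : ℝ≥0) := by
          rw [NNReal.coe_max, coe_toNNReal _ hM0]; exact le_max_right _ _
        _ ≤ _ := le_mul_of_one_le_right (by positivity) hxy
  refine ⟨max C M.toNNReal, LipschitzWith.of_dist_le_mul fun x y => ?_⟩
  by_cases hx : x ∈ tsupport f
  · exact key x y hx
  by_cases hy : y ∈ tsupport f
  · rw [dist_comm, dist_comm x]; exact key y x hy
  · simp only [image_eq_zero_of_notMem_tsupport hx, image_eq_zero_of_notMem_tsupport hy, dist_self]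
    positivity

theorem LocallyLipschitzOn.ae_differentiableAt [NormedSpace ℝ E] [NormedSpace ℝ F]
    [FiniteDimensional ℝ E] [FiniteDimensional ℝ F]
    [MeasurableSpace E] [BorelSpace E]
    {μ : Measure E} [μ.IsAddHaarMeasure] {f : E → F} {S : Set E}
    (hf : LocallyLipschitzOn S f) (hS : IsOpen S) :
    ∀ᵐ z ∂μ.restrict S, DifferentiableAt ℝ f z := by
  rw [ae_restrict_iff' hS.measurableSet, ae_iff]
  apply measure_null_of_locally_null
  intro z hz
  have hzS : z ∈ S := by
    by_contra h
    exact hz (fun h' => absurd h' h)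
  obtain ⟨K, t, ht, hK⟩ := hf hzS
  rw [hS.nhdsWithin_eq hzS] at ht
  refine ⟨interior t ∩ {z | ¬ (z ∈ S → DifferentiableAt ℝ f z)}, inter_mem
    (mem_nhdsWithin_of_mem_nhds (interior_mem_nhds.2 ht)) self_mem_nhdsWithin, ?_⟩
  have h := (hK.mono interior_subset).ae_differentiableWithinAt_of_mem (μ := μ)
  rw [ae_iff] at h
  refine measure_mono_null ?_ h
  rintro x ⟨hx1, hx2⟩ h'
  exact hx2 fun _ => (h' hx1).differentiableAt (isOpen_interior.mem_nhds hx1)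

end LocallyLipschitz

instance isAddHaarMeasure_volume_euc_prod (N : ℕ) :
    (volume : Measure (Euc N × ℝ)).IsAddHaarMeasure :=
  Measure.prod.instIsAddHaarMeasure (volume : Measure (Euc N)) (volume : Measure ℝ)

theorem isOpen_Sset (N : ℕ) : IsOpen (Sset N) := isOpen_lt continuous_const continuous_snd

theorem muS_eq {N : ℕ} {a : Euc N → ℝ} (ha : Continuous a) :
    muS a = ((volume : Measure (Euc N × ℝ)).restrict (Sset N)).withDensity
      (fun z => ENNReal.ofReal (a z.1)) := by
  unfold muS muA
  rw [prod_withDensity_left (by fun_prop)]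
  congr 1
  have : Sset N = univ ×ˢ Ioi 0 := by ext z; simp [Sset]
  rw [this, Measure.volume_eq_prod, ← Measure.prod_restrict, Measure.restrict_univ]

theorem muS_le {N : ℕ} {a : Euc N → ℝ} (ha : Continuous a) :
    muS a ≤ (volume : Measure (Euc N × ℝ)).withDensity (fun z => ENNReal.ofReal (a z.1)) := by
  rw [muS_eq ha, ← restrict_withDensity (isOpen_Sset N).measurableSet]
  exact Measure.restrict_le_self

theorem isLocallyFiniteMeasure_muS {N : ℕ} {a : Euc N → ℝ} (ha : Continuous a) :
    IsLocallyFiniteMeasure (muS a) := by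
  have : IsLocallyFiniteMeasure ((volume : Measure (Euc N × ℝ)).withDensity
      (fun z => ENNReal.ofReal (a z.1))) :=
    IsLocallyFiniteMeasure.withDensity_ofReal (by fun_prop)
  exact Measure.isLocallyFiniteMeasure_of_le (muS_le ha)

theorem muS_absolutelyContinuous {N : ℕ} {a : Euc N → ℝ} (ha : Continuous a) :
    muS a ≪ (volume : Measure (Euc N × ℝ)).restrict (Sset N) := by
  rw [muS_eq ha]; exact withDensity_absolutelyContinuous _ _

theorem absolutelyContinuous_muS {N : ℕ} {a : Euc N → ℝ} (ha : Continuous a)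
    (haPos : ∀ᵐ x ∂ (volume : Measure (Euc N)), 0 < a x) :
    (volume : Measure (Euc N × ℝ)).restrict (Sset N) ≪ muS a := by
  rw [muS_eq ha]
  apply withDensity_absolutelyContinuous' (by fun_prop)
  apply ae_restrict_of_ae
  have := Measure.quasiMeasurePreserving_fst (μ := (volume : Measure (Euc N)))
    (ν := (volume : Measure ℝ)) |>.ae haPos
  filter_upwards [this] with z hz
  simpa using hz

theorem ae_mem_Sset {N : ℕ} {a : Euc N → ℝ} (ha : Continuous a) : ∀ᵐ z ∂muS a, z ∈ Sset N :=
  (muS_absolutelyContinuous ha).ae_le (ae_restrict_mem (isOpen_Sset N).measurableSet)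

theorem integral_fderiv_time_muS {N : ℕ} {a : Euc N → ℝ} (ha : Continuous a)
    {P : Euc N × ℝ → ℝ} (hP : LocallyLipschitz P) (hc : HasCompactSupport P)
    (hS : tsupport P ⊆ Sset N) : ∫ z, fderiv ℝ P z (0, 1) ∂muS a = 0 := by
  obtain ⟨C, hC⟩ := hP.exists_lipschitzWith_of_hasCompactSupport hc
  have hA : Continuous fun z : Euc N × ℝ => max (a z.1) 0 := by fun_prop
  have hlim := hC.integral_inv_smul_sub_mul_tendsto_integral_lineDeriv_mul'
    (μ := (volume : Measure (Euc N × ℝ))) hc hA (0, 1)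
  have hzero : ∀ t : ℝ, ∫ x : Euc N × ℝ,
      (t⁻¹ • (P (x + t • (0, 1)) - P x)) * max (a x.1) 0 = 0 := by
    intro t
    have hPa : Integrable (fun x : Euc N × ℝ => P x * max (a x.1) 0) :=
      (hP.continuous.mul hA).integrable_of_hasCompactSupport hc.mul_right
    have hPa' := hPa.comp_add_right (t • ((0 : Euc N), (1 : ℝ)))
    have h2 := integral_add_right_eq_self (μ := (volume : Measure (Euc N × ℝ)))
      (fun x => P x * max (a x.1) 0) (t • ((0 : Euc N), (1 : ℝ)))
    calc _ = ∫ x : Euc N × ℝ, t⁻¹ * (P (x + t • (0, 1)) * max (a (x + t • (0, 1)).1) 0 -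
          P x * max (a x.1) 0) := by
          congr 1; ext x; simp; ring
      _ = 0 := by rw [integral_const_mul, integral_sub hPa' hPa, h2, sub_self, mul_zero]
  have h0 : ∫ x : Euc N × ℝ, lineDeriv ℝ P x (0, 1) * max (a x.1) 0 = 0 := by
    refine tendsto_nhds_unique hlim ?_
    simp only [hzero]; exact tendsto_const_nhds
  rw [muS_eq ha, integral_withDensity_eq_integral_toReal_smul (by fun_prop) (by simp), ← h0,
    setIntegral_eq_integral_of_ae_compl_eq_zero]
  · apply integral_congr_ae
    filter_upwards [hC.ae_differentiableAt] with z hz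
    rw [hz.lineDeriv_eq_fderiv, smul_eq_mul, mul_comm, ENNReal.toReal_ofReal']
  · refine Eventually.of_forall fun z hz => ?_
    have : z ∉ tsupport (fderiv ℝ P) := fun h => hz (hS (tsupport_fderiv_subset ℝ h))
    rw [image_eq_zero_of_notMem_tsupport this]; simp

end

section

/-- A logarithmic space-time gauge adapted to the scaling `t ∼ |x|^γ`. -/
def logGauge {N : ℕ} (γ : ℝ) (z : Euc N × ℝ) : ℝ :=
  log (‖z.1‖ ^ (γ + 1) + z.2 ^ ((γ + 1) / γ)) / (γ + 1)

/-- The logarithmic cutoff: `1` for gauge at most `n`, `0` for gauge at least `2 * n`. -/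
def cut {N : ℕ} (γ n : ℝ) (z : Euc N × ℝ) : ℝ := max 0 (min 1 (2 - logGauge γ z / n))

variable {N : ℕ} {γ : ℝ}

theorem exp_gauge (hγ : 0 < γ) {z : Euc N × ℝ} (hz : z ∈ Sset N) :
    exp ((γ + 1) * logGauge γ z) = ‖z.1‖ ^ (γ + 1) + z.2 ^ ((γ + 1) / γ) := by
  have hz : 0 < z.2 := hz
  unfold logGauge
  rw [mul_div_cancel₀ _ (by positivity), exp_log (by positivity)]

theorem norm_le_exp_gauge (hγ : 0 < γ) {z : Euc N × ℝ} (hz : z ∈ Sset N) :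
    ‖z.1‖ ≤ exp (logGauge γ z) := by
  have hz' : 0 < z.2 := hz
  rw [← rpow_le_rpow_iff (norm_nonneg _) (exp_pos _).le (show 0 < γ + 1 by positivity),
    ← Real.exp_mul, mul_comm, exp_gauge hγ hz]
  have : 0 < z.2 ^ ((γ + 1) / γ) := by positivity
  linarith

theorem time_le_exp_gauge (hγ : 0 < γ) {z : Euc N × ℝ} (hz : z ∈ Sset N) :
    z.2 ≤ exp (γ * logGauge γ z) := by
  have hz' : 0 < z.2 := hz
  rw [← rpow_le_rpow_iff hz'.le (exp_pos _).le (show 0 < (γ + 1) / γ by positivity),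
    ← Real.exp_mul]
  have : γ * logGauge γ z * ((γ + 1) / γ) = (γ + 1) * logGauge γ z := by field_simp
  rw [this, exp_gauge hγ hz]
  have : 0 ≤ ‖z.1‖ ^ (γ + 1) := by positivity
  linarith

theorem measurable_gauge : Measurable (logGauge (N := N) γ) := by
  unfold logGauge
  exact (Real.measurable_log.comp ((measurable_fst.norm.pow_const _).add
    (measurable_snd.pow_const _))).div_const _

theorem measurable_cut (n : ℝ) : Measurable (cut (N := N) γ n) :=
  measurable_const.max (measurable_const.min
    (measurable_const.sub (measurable_gauge.div_const _)))

theorem contDiffAt_gauge (hγ : 0 < γ) {z : Euc N × ℝ} (hz : z ∈ Sset N) :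
    ContDiffAt ℝ 1 (logGauge γ) z := by
  have hz' : 0 < z.2 := hz
  unfold logGauge
  refine ContDiffAt.div_const (ContDiffAt.log (ContDiffAt.add ?_ ?_) (by positivity)) _
  · exact (contDiff_fst.norm_rpow (show 1 < γ + 1 by linarith)).contDiffAt
  · exact contDiffAt_snd.rpow_const_of_ne hz'.ne'

theorem locallyLipschitzOn_cut (hγ : 0 < γ) (n : ℝ) :
    LocallyLipschitzOn (Sset N) (cut (N := N) γ n) := by
  have h1 : LocallyLipschitzOn (Sset N) (logGauge (N := N) γ) :=
    ContDiffAt.locallyLipschitzOn' fun z hz => contDiffAt_gauge hγ hz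
  have h2 : LocallyLipschitz (fun y : ℝ => max 0 (min 1 (2 - y / n))) := by
    refine LocallyLipschitz.const_max (LocallyLipschitz.const_min ?_ 1) 0
    exact ContDiff.locallyLipschitz (𝕂 := ℝ) (by fun_prop)
  intro z hz
  obtain ⟨K, t, ht, hK⟩ := h1 hz
  obtain ⟨K', t', ht', hK'⟩ := h2 (logGauge γ z)
  exact ⟨K' * K, t ∩ logGauge γ ⁻¹' t', inter_mem ht ((h1.continuousOn z hz) ht'),
    hK'.comp (hK.mono inter_subset_left) (fun x hx => hx.2)⟩

theorem cut_nonneg (n : ℝ) (z : Euc N × ℝ) : 0 ≤ cut γ n z := le_max_left _ _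

theorem cut_le_one (n : ℝ) (z : Euc N × ℝ) : cut γ n z ≤ 1 :=
  max_le zero_le_one (min_le_left _ _)

theorem gauge_lt_of_cut_pos {n : ℝ} (hn : 0 < n) {z : Euc N × ℝ} (h : 0 < cut γ n z) :
    logGauge γ z < 2 * n := by
  unfold cut at h
  simp only [lt_max_iff, lt_irrefl, lt_min_iff, false_or] at h
  have := h.2
  rw [sub_pos, div_lt_iff₀ hn] at this
  exact this

theorem lt_gauge_of_cut_lt_one {n : ℝ} (hn : 0 < n) {z : Euc N × ℝ} (h : cut γ n z < 1) :
    n < logGauge γ z := by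
  unfold cut at h
  simp only [max_lt_iff, min_lt_iff, lt_irrefl, false_or] at h
  have := h.2
  have h3 : 1 < logGauge γ z / n := by linarith
  rwa [lt_div_iff₀ hn, one_mul] at h3

theorem cut_eq_one {n : ℝ} (hn : 0 < n) {z : Euc N × ℝ} (h : logGauge γ z ≤ n) :
    cut γ n z = 1 := by
  by_contra h'
  exact absurd (lt_gauge_of_cut_lt_one hn (lt_of_le_of_ne (cut_le_one n z) h')) (not_lt.2 h)

theorem gauge_eq_of_cut {n : ℝ} (hn : 0 < n) {z : Euc N × ℝ} (h0 : 0 < cut γ n z)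
    (h1 : cut γ n z < 1) : logGauge γ z = n * (2 - cut γ n z) := by
  have h2 := gauge_lt_of_cut_pos hn h0
  have h3 := lt_gauge_of_cut_lt_one hn h1
  have : cut γ n z = 2 - logGauge γ z / n := by
    unfold cut
    have h4 : logGauge γ z / n < 2 := by rwa [div_lt_iff₀ hn]
    have h5 : 1 < logGauge γ z / n := by rwa [lt_div_iff₀ hn, one_mul]
    rw [min_eq_right (by linarith), max_eq_right (by linarith)]
  rw [this]; field_simp; ring

theorem exists_fderiv_gauge (hγ : 0 < γ) {z : Euc N × ℝ} (hz : z ∈ Sset N) :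
    ∃ D : (Euc N × ℝ) →L[ℝ] ℝ, HasFDerivAt (logGauge γ) D z ∧
      (∀ w, |D (w, 0)| ≤ exp (-logGauge γ z) * ‖w‖) ∧
      |D (0, 1)| ≤ exp (-(γ * logGauge γ z)) / γ := by
  have hz' : 0 < z.2 := hz
  have hnorm := norm_le_exp_gauge hγ hz
  have htime := time_le_exp_gauge hγ hz
  have hQ := exp_gauge hγ hz
  have hQ0 : 0 < ‖z.1‖ ^ (γ + 1) + z.2 ^ ((γ + 1) / γ) := by positivity
  have d1 : HasFDerivAt (fun z : Euc N × ℝ => ‖z.1‖ ^ (γ + 1)) _ z :=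
    (hasFDerivAt_norm_rpow z.1 (show 1 < γ + 1 by linarith)).comp z hasFDerivAt_fst
  have d2 : HasFDerivAt (fun z : Euc N × ℝ => z.2 ^ ((γ + 1) / γ)) _ z :=
    (hasFDerivAt_snd (p := z)).rpow_const (Or.inl hz'.ne')
  have d3 := ((d1.add d2).log hQ0.ne').mul_const (γ + 1)⁻¹
  refine ⟨_, d3, ?_, ?_⟩
  · intro w
    simp only [smul_apply, add_apply, smul_eq_mul,
      ContinuousLinearMap.comp_apply, ContinuousLinearMap.coe_fst', ContinuousLinearMap.coe_snd',
      innerSL_apply_apply, mul_zero, add_zero, Pi.add_apply]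
    rw [← hQ]
    have hi := abs_real_inner_le_norm z.1 w
    have hx : ‖z.1‖ ^ (γ + 1 - 2) * ‖z.1‖ = ‖z.1‖ ^ γ := by
      rcases (norm_nonneg z.1).eq_or_lt with h | h
      · rw [← h, mul_zero, zero_rpow hγ.ne']
      · rw [← rpow_add_one h.ne']; congr 1; ring
    have hx' : ‖z.1‖ ^ γ ≤ exp (logGauge γ z * γ) := by
      rw [Real.exp_mul]; gcongr
    rw [abs_mul, abs_mul, abs_mul, abs_mul, abs_of_pos (by positivity : 0 < (γ + 1)⁻¹),
      abs_of_pos (by positivity : 0 < γ + 1), abs_of_pos (by positivity :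
        0 < (exp ((γ + 1) * logGauge γ z))⁻¹), abs_of_nonneg (by positivity :
        0 ≤ ‖z.1‖ ^ (γ + 1 - 2))]
    calc _ = (exp ((γ + 1) * logGauge γ z))⁻¹ * (‖z.1‖ ^ (γ + 1 - 2) * |⟪z.1, w⟫|) := by
          field_simp
      _ ≤ (exp ((γ + 1) * logGauge γ z))⁻¹ * (‖z.1‖ ^ (γ + 1 - 2) * (‖z.1‖ * ‖w‖)) := by gcongr
      _ = (exp ((γ + 1) * logGauge γ z))⁻¹ * (‖z.1‖ ^ γ * ‖w‖) := by rw [← hx]; ring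
      _ ≤ (exp ((γ + 1) * logGauge γ z))⁻¹ * (exp (logGauge γ z * γ) * ‖w‖) := by gcongr
      _ = _ := by
        rw [← Real.exp_neg, ← mul_assoc, ← Real.exp_add]; congr 2; ring
  · simp only [smul_apply, add_apply, smul_eq_mul,
      ContinuousLinearMap.comp_apply, ContinuousLinearMap.coe_fst', ContinuousLinearMap.coe_snd',
      innerSL_apply_apply, inner_zero_right, mul_zero, zero_add, Pi.add_apply, mul_one]
    rw [← hQ]
    have he : (γ + 1) / γ - 1 = γ⁻¹ := by field_simp; ring
    have ht : z.2 ^ γ⁻¹ ≤ exp (logGauge γ z) := by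
      calc z.2 ^ γ⁻¹ ≤ (exp (γ * logGauge γ z)) ^ γ⁻¹ := by gcongr
        _ = _ := by rw [← Real.exp_mul]; congr 1; field_simp
    rw [he, abs_of_nonneg (by positivity)]
    calc _ = (exp ((γ + 1) * logGauge γ z))⁻¹ * z.2 ^ γ⁻¹ / γ := by field_simp
      _ ≤ (exp ((γ + 1) * logGauge γ z))⁻¹ * exp (logGauge γ z) / γ := by gcongr
      _ = _ := by
        rw [← Real.exp_neg, ← Real.exp_add]; congr 2; ring

/-- The differential of the cutoff, wherever it exists, is controlled by the gauge and vanishes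
off the transition region. -/
theorem fderiv_cut_bound (hγ : 0 < γ) {n : ℝ} (hn : 0 < n) {z : Euc N × ℝ} (hz : z ∈ Sset N)
    {D : (Euc N × ℝ) →L[ℝ] ℝ} (hD : HasFDerivAt (cut γ n) D z) :
    ((0 < cut γ n z ∧ cut γ n z < 1) ∨ D = 0) ∧
    (∀ w, |D (w, 0)| ≤ exp (-(n * (2 - cut γ n z))) / n * ‖w‖) ∧
      |D (0, 1)| ≤ exp (-(γ * (n * (2 - cut γ n z)))) / γ / n := by
  have triv : D = 0 → ((0 < cut γ n z ∧ cut γ n z < 1) ∨ D = 0) ∧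
    (∀ w, |D (w, 0)| ≤ exp (-(n * (2 - cut γ n z))) / n * ‖w‖) ∧
      |D (0, 1)| ≤ exp (-(γ * (n * (2 - cut γ n z)))) / γ / n := by
    rintro rfl
    refine ⟨Or.inr rfl, fun w => ?_, ?_⟩ <;>
    · simp only [zero_apply, abs_zero]; positivity
  rcases (cut_nonneg n z).eq_or_lt with h0 | h0
  · apply triv
    apply IsLocalMin.hasFDerivAt_eq_zero _ hD
    exact Eventually.of_forall fun y => by rw [← h0]; exact cut_nonneg n y
  rcases (cut_le_one n z).eq_or_lt with h1 | h1
  · apply triv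
    apply IsLocalMax.hasFDerivAt_eq_zero _ hD
    exact Eventually.of_forall fun y => by rw [h1]; exact cut_le_one n y
  obtain ⟨G, hG, hG1, hG2⟩ := exists_fderiv_gauge hγ hz
  have hev : cut γ n =ᶠ[𝓝 z] fun y => 2 - logGauge γ y / n := by
    have hc : ContinuousAt (logGauge γ) z := hG.continuousAt
    filter_upwards [hc.eventually_lt_const (gauge_lt_of_cut_pos hn h0),
      hc.eventually_const_lt (lt_gauge_of_cut_lt_one hn h1)] with y hy1 hy2
    unfold cut
    have h4 : logGauge γ y / n < 2 := by rwa [div_lt_iff₀ hn]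
    have h5 : 1 < logGauge γ y / n := by rwa [lt_div_iff₀ hn, one_mul]
    rw [min_eq_right (by linarith), max_eq_right (by linarith)]
  have hD' : D = -(n⁻¹ • G) := by
    refine (hD.congr_of_eventuallyEq hev.symm).unique ?_
    simpa only [div_eq_mul_inv] using (hG.mul_const n⁻¹).const_sub 2
  rw [gauge_eq_of_cut hn h0 h1] at hG1 hG2
  refine ⟨Or.inl ⟨h0, h1⟩, fun w => ?_, ?_⟩
  · rw [hD', neg_apply, smul_apply, abs_neg, smul_eq_mul,
      abs_mul, abs_of_pos (inv_pos.2 hn)]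
    calc _ ≤ n⁻¹ * (exp (-(n * (2 - cut γ n z))) * ‖w‖) := by gcongr; exact hG1 w
      _ = _ := by field_simp
  · rw [hD', neg_apply, smul_apply, abs_neg, smul_eq_mul,
      abs_mul, abs_of_pos (inv_pos.2 hn)]
    calc _ ≤ n⁻¹ * (exp (-(γ * (n * (2 - cut γ n z)))) / γ) := by gcongr
      _ = _ := by field_simp

theorem chi_nonneg (β t : ℝ) : 0 ≤ chi β t := le_min zero_le_one (le_max_left _ _)

theorem chi_le_one (β t : ℝ) : chi β t ≤ 1 := min_le_left _ _

theorem chi_monotone {β : ℝ} (hβ : 0 < β) : Monotone (chi β) := by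
  intro s t h
  unfold chi
  gcongr

theorem chi_eq_zero {β t : ℝ} (hβ : 0 < β) (h : t ≤ β) : chi β t = 0 := by
  have : t / β ≤ 1 := by rwa [div_le_one hβ]
  unfold chi
  rw [max_eq_left (by linarith), min_eq_right zero_le_one]

theorem chi_eq_one {β t : ℝ} (hβ : 0 < β) (h : 2 * β ≤ t) : chi β t = 1 := by
  have : 2 ≤ t / β := by rwa [le_div_iff₀ hβ]
  unfold chi
  rw [min_eq_left]
  exact le_max_of_le_right (by linarith)

theorem locallyLipschitz_chi (β : ℝ) : LocallyLipschitz (chi β) := by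
  refine LocallyLipschitz.const_min (LocallyLipschitz.const_max ?_ 0) 1
  exact ContDiff.locallyLipschitz (𝕂 := ℝ) (by fun_prop)

end

section

/-- The compact set carrying the test functions. -/
def core (N : ℕ) (γ n β : ℝ) : Set (Euc N × ℝ) :=
  closedBall 0 (exp (2 * n)) ×ˢ Icc β (exp (γ * (2 * n)))

variable {N : ℕ} {γ n β : ℝ}

theorem isCompact_core : IsCompact (core N γ n β) :=
  (isCompact_closedBall _ _).prod isCompact_Icc

theorem core_subset (hβ : 0 < β) : core N γ n β ⊆ Sset N :=
  fun _ hz => lt_of_lt_of_le hβ hz.2.1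

theorem mem_core (hγ : 0 < γ) (hn : 0 < n) (hβ : 0 < β) {z : Euc N × ℝ} (hc : chi β z.2 ≠ 0)
    (hη : cut γ n z ≠ 0) : z ∈ core N γ n β := by
  have h1 : β < z.2 := by
    by_contra h
    exact hc (chi_eq_zero hβ (not_lt.1 h))
  have hz : z ∈ Sset N := hβ.trans h1
  have h2 := (gauge_lt_of_cut_pos hn (lt_of_le_of_ne (cut_nonneg n z) hη.symm)).le
  refine ⟨?_, h1.le, (time_le_exp_gauge hγ hz).trans (by gcongr)⟩
  rw [mem_closedBall_zero_iff]
  exact (norm_le_exp_gauge hγ hz).trans (by gcongr)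

theorem testFun_regular (hγ : 0 < γ) (hn : 0 < n) (hβ : 0 < β) {G : ℝ × ℝ × ℝ → ℝ}
    (hG : ∀ c η v, 0 ≤ v → ContDiffAt ℝ 1 G (c, η, v)) (h0 : ∀ η v, G (0, η, v) = 0)
    (h1 : ∀ c v, G (c, 0, v) = 0) {u : Euc N × ℝ → ℝ} (hu : LocallyLipschitzOn (Sset N) u)
    (hu0 : ∀ z ∈ Sset N, 0 ≤ u z) :
    LocallyLipschitz (fun z => G (chi β z.2, cut γ n z, u z)) ∧
      HasCompactSupport (fun z => G (chi β z.2, cut γ n z, u z)) ∧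
      tsupport (fun z => G (chi β z.2, cut γ n z, u z)) ⊆ core N γ n β := by
  have hsupp : Function.support (fun z => G (chi β z.2, cut γ n z, u z)) ⊆ core N γ n β := by
    intro z hz
    refine mem_core hγ hn hβ (fun h => hz ?_) (fun h => hz ?_)
    · simp only [h, h0]
    · simp only [h, h1]
  have hts : tsupport (fun z => G (chi β z.2, cut γ n z, u z)) ⊆ core N γ n β :=
    closure_minimal hsupp isCompact_core.isClosed
  refine ⟨?_, isCompact_core.of_isClosed_subset (isClosed_tsupport _) hts, hts⟩
  refine LocallyLipschitzOn.locallyLipschitz_of_tsupport_subset (S := Sset N) ?_ (isOpen_Sset N)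
    (hts.trans (core_subset hβ))
  have hχ : LocallyLipschitzOn (Sset N) (fun z : Euc N × ℝ => chi β z.2) := by
    have : LocallyLipschitz (fun z : Euc N × ℝ => chi β z.2) :=
      (locallyLipschitz_chi β).comp LipschitzWith.prod_snd.locallyLipschitz
    exact this.locallyLipschitzOn
  exact (hχ.prodMk' ((locallyLipschitzOn_cut hγ n).prodMk' hu)).contDiffAt_comp
    fun z hz => hG _ _ _ (hu0 z hz)

variable {p m q α s δ ε : ℝ}

/-- The truncated primitive of `(u + ε) ^ (-α)`. -/
def prim (α ε v : ℝ) : ℝ := ((v + ε) ^ (1 - α) - ε ^ (1 - α)) / (1 - α)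

theorem prim_nonneg (hα1 : α < 1) (hε : 0 < ε) {v : ℝ} (hv : 0 ≤ v) : 0 ≤ prim α ε v := by
  have : ε ^ (1 - α) ≤ (v + ε) ^ (1 - α) :=
    rpow_le_rpow hε.le (by linarith) (by linarith)
  exact div_nonneg (by linarith) (by linarith)

theorem prim_le (hα1 : α < 1) (hε : 0 < ε) (v : ℝ) :
    prim α ε v ≤ (v + ε) ^ (1 - α) / (1 - α) := by
  have : 0 ≤ ε ^ (1 - α) := by positivity
  exact div_le_div_of_nonneg_right (by linarith) (by linarith)

theorem hasDerivAt_prim (hα1 : α < 1) {v : ℝ} (hv : 0 < v + ε) :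
    HasDerivAt (prim α ε) ((v + ε) ^ (-α)) v := by
  have h := ((((hasDerivAt_id v).add_const ε).rpow_const (p := 1 - α) (Or.inl hv.ne')).sub_const
    (ε ^ (1 - α))).div_const (1 - α)
  refine h.congr_deriv ?_
  have : 1 - α ≠ 0 := by linarith
  simp only [id]
  rw [show 1 - α - 1 = -α by ring]
  field_simp

/-- The profile of the test function. -/
def profile (p m q α s n ε : ℝ) (x : ℝ × ℝ × ℝ) : ℝ :=
  x.1 * (x.2.1 ^ s + wt p m q α s n x.2.1 * (x.2.2 + ε) ^ (-α))

/-- The profile of the correction absorbing the time derivative of the solution. -/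
def corrector (p m q α s n ε : ℝ) (x : ℝ × ℝ × ℝ) : ℝ :=
  x.1 * (wt p m q α s n x.2.1 * (prim α ε x.2.2 - (x.2.2 + ε) ^ (-α) * x.2.2))

theorem contDiffAt_wt (hs1 : 1 < s) (n η : ℝ) : ContDiffAt ℝ 1 (wt p m q α s n) η := by
  unfold wt
  have : ContDiff ℝ 1 (fun η : ℝ => η ^ s) := contDiff_rpow_const_of_le (by exact_mod_cast hs1.le)
  fun_prop

theorem contDiffAt_profile (hs1 : 1 < s) (hε : 0 < ε) (c η v : ℝ) (hv : 0 ≤ v) :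
    ContDiffAt ℝ 1 (profile p m q α s n ε) (c, η, v) := by
  unfold profile
  have h1 : ContDiffAt ℝ 1 (fun x : ℝ × ℝ × ℝ => x.2.1 ^ s) (c, η, v) := by
    have : ContDiff ℝ 1 (fun η : ℝ => η ^ s) :=
      contDiff_rpow_const_of_le (by exact_mod_cast hs1.le)
    fun_prop
  have h2 : ContDiffAt ℝ 1 (fun x : ℝ × ℝ × ℝ => wt p m q α s n x.2.1) (c, η, v) :=
    ContDiffAt.comp (f := fun x : ℝ × ℝ × ℝ => x.2.1) (c, η, v) (contDiffAt_wt hs1 n η)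
      (contDiffAt_fst.comp _ contDiffAt_snd)
  have h3 : ContDiffAt ℝ 1 (fun x : ℝ × ℝ × ℝ => (x.2.2 + ε) ^ (-α)) (c, η, v) :=
    ContDiffAt.rpow_const_of_ne (by fun_prop) (by simp only; positivity)
  fun_prop

theorem contDiffAt_corrector (hs1 : 1 < s) (hε : 0 < ε) (c η v : ℝ) (hv : 0 ≤ v) :
    ContDiffAt ℝ 1 (corrector p m q α s n ε) (c, η, v) := by
  unfold corrector prim
  have h2 : ContDiffAt ℝ 1 (fun x : ℝ × ℝ × ℝ => wt p m q α s n x.2.1) (c, η, v) :=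
    ContDiffAt.comp (f := fun x : ℝ × ℝ × ℝ => x.2.1) (c, η, v) (contDiffAt_wt hs1 n η)
      (contDiffAt_fst.comp _ contDiffAt_snd)
  have h3 (r : ℝ) : ContDiffAt ℝ 1 (fun x : ℝ × ℝ × ℝ => (x.2.2 + ε) ^ r) (c, η, v) :=
    ContDiffAt.rpow_const_of_ne (by fun_prop) (by simp only; positivity)
  have := h3 (-α)
  have := h3 (1 - α)
  fun_prop

theorem wt_zero (hs1 : 1 < s) (n : ℝ) : wt p m q α s n 0 = 0 := by
  unfold wt
  rw [zero_rpow (by linarith), mul_zero]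

variable {E : Type*} [NormedAddCommGroup E] [NormedSpace ℝ E] {c η u : E → ℝ}
  {Dc Dη Du : E →L[ℝ] ℝ} {z : E}

theorem hasFDerivAt_profile (hs1 : 1 < s) (hc : HasFDerivAt c Dc z) (hη : HasFDerivAt η Dη z)
    (hu : HasFDerivAt u Du z) (hv : 0 < u z + ε) :
    HasFDerivAt (fun z => profile p m q α s n ε (c z, η z, u z))
      ((η z ^ s + wt p m q α s n (η z) * (u z + ε) ^ (-α)) • Dc +
        (c z * (s * η z ^ (s - 1) + wt' p m q α s n (η z) * (u z + ε) ^ (-α))) • Dη +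
        (-(c z * (α * wt p m q α s n (η z) * (u z + ε) ^ (-α - 1)))) • Du) z := by
  have h1 := hη.rpow_const (p := s) (Or.inr hs1.le)
  have h2 := (hasDerivAt_wt (p := p) (m := m) (q := q) (α := α) hs1 n (η z)).comp_hasFDerivAt z hη
  have h3 := (hu.add_const ε).rpow_const (p := -α) (Or.inl hv.ne')
  refine (hc.mul (h1.add (h2.mul h3))).congr_fderiv ?_
  ext w
  simp only [add_apply, smul_apply, smul_eq_mul, Pi.add_apply, Pi.mul_apply,
    Function.comp_apply]
  ring

theorem hasFDerivAt_corrector (hs1 : 1 < s) (hα1 : α < 1) (hc : HasFDerivAt c Dc z)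
    (hη : HasFDerivAt η Dη z) (hu : HasFDerivAt u Du z) (hv : 0 < u z + ε) :
    HasFDerivAt (fun z => corrector p m q α s n ε (c z, η z, u z))
      ((wt p m q α s n (η z) * (prim α ε (u z) - (u z + ε) ^ (-α) * u z)) • Dc +
        (c z * (wt' p m q α s n (η z) * (prim α ε (u z) - (u z + ε) ^ (-α) * u z))) • Dη +
        (c z * (α * wt p m q α s n (η z) * (u z + ε) ^ (-α - 1) * u z)) • Du) z := by
  have h1 := (hasDerivAt_prim hα1 hv).comp_hasFDerivAt z hu
  have h2 := (hasDerivAt_wt (p := p) (m := m) (q := q) (α := α) hs1 n (η z)).comp_hasFDerivAt z hη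
  have h3 := (hu.add_const ε).rpow_const (p := -α) (Or.inl hv.ne')
  refine (hc.mul (h2.mul (h1.sub (h3.mul hu)))).congr_fderiv ?_
  ext w
  simp only [add_apply, sub_apply, smul_apply, smul_eq_mul, Pi.mul_apply, Pi.sub_apply,
    Function.comp_apply]
  ring

end

section

variable {N : ℕ} {p m q α s δ ε γ n β : ℝ}

theorem integrable_of_continuousOn_of_core {a : Euc N → ℝ} (ha : Continuous a) (hβ : 0 < β)
    {F : Euc N × ℝ → ℝ} (hF : ContinuousOn F (Sset N)) (h0 : ∀ z, z ∉ core N γ n β → F z = 0) :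
    Integrable F (muS a) := by
  have := isLocallyFiniteMeasure_muS ha
  have h := (hF.mono (core_subset hβ)).integrableOn_compact (μ := muS a)
    (isCompact_core (N := N) (γ := γ) (n := n) (β := β))
  rw [← integrable_indicator_iff isCompact_core.isClosed.measurableSet] at h
  refine h.congr (.of_forall fun z => ?_)
  by_cases hz : z ∈ core N γ n β
  · rw [indicator_of_mem hz]
  · rw [indicator_of_notMem hz, h0 z hz]

theorem integrable_fderiv_mul {a : Euc N → ℝ} (ha : Continuous a) (hβ : 0 < β)
    {F w : Euc N × ℝ → ℝ} (hF : LocallyLipschitz F) (hc : HasCompactSupport F)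
    (hts : tsupport F ⊆ core N γ n β) (hw : ContinuousOn w (Sset N)) (v : Euc N × ℝ) :
    Integrable (fun z => fderiv ℝ F z v * w z) (muS a) := by
  have := isLocallyFiniteMeasure_muS ha
  obtain ⟨L, hL⟩ := hF.exists_lipschitzWith_of_hasCompactSupport hc
  have h := (hw.mono (core_subset hβ)).integrableOn_compact (μ := muS a)
    (isCompact_core (N := N) (γ := γ) (n := n) (β := β))
  have h2 := h.bdd_mul (f := fun z => fderiv ℝ F z v) (c := L * ‖v‖)
    (measurable_fderiv_apply_const ℝ F v).aestronglyMeasurable (Eventually.of_forall fun z =>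
      ((fderiv ℝ F z).le_opNorm v).trans (by gcongr; exact norm_fderiv_le_of_lipschitz ℝ hL))
  have h3 : IntegrableOn (fun z => fderiv ℝ F z v * w z) (core N γ n β) (muS a) := h2
  rw [← integrable_indicator_iff isCompact_core.isClosed.measurableSet] at h3
  refine h3.congr (.of_forall fun z => ?_)
  by_cases hz : z ∈ core N γ n β
  · rw [indicator_of_mem hz]
  · rw [indicator_of_notMem hz]
    have : fderiv ℝ F z = 0 := by
      by_contra h'
      exact hz (hts (support_fderiv_subset ℝ h'))
    simp only [this, zero_apply, zero_mul]

theorem fderiv_chi {z : Euc N × ℝ} (hβ : 0 < β) {D : (Euc N × ℝ) →L[ℝ] ℝ}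
    (hD : HasFDerivAt (fun z : Euc N × ℝ => chi β z.2) D z) :
    (∀ w, D (w, 0) = 0) ∧ 0 ≤ D (0, 1) := by
  constructor
  · intro w
    have h := hD.hasLineDerivAt (w, 0)
    unfold HasLineDerivAt at h
    simp only [Prod.snd_add, Prod.smul_snd, smul_zero, add_zero] at h
    exact h.unique (hasDerivAt_const _ _)
  · have h := hD.hasLineDerivAt (0, 1)
    unfold HasLineDerivAt at h
    rw [← h.deriv]
    refine Monotone.deriv_nonneg ?_
    intro x y hxy
    refine chi_monotone hβ ?_
    simpa using hxy

/-- The transition region of the cutoff. -/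
def annulus (N : ℕ) (γ n : ℝ) : Set (Euc N × ℝ) := {z | 0 < cut γ n z ∧ cut γ n z < 1}

theorem measurableSet_annulus : MeasurableSet (annulus N γ n) :=
  (measurableSet_lt measurable_const (measurable_cut n)).inter
    (measurableSet_lt (measurable_cut n) measurable_const)

/-- The density bounding the error terms of the test function method. -/
def errorDensity (p m q α s δ γ Λ n β ε : ℝ) (u : Euc N × ℝ → ℝ) : Euc N × ℝ → ℝ :=
  (annulus N γ n).indicator
    fun z => chi β z.2 * remainder p m q α s δ Λ n (cut γ n z) (u z + ε)

/-- The spatial part of a space-time differential. -/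
def spatialGrad (D : (Euc N × ℝ) →L[ℝ] ℝ) : Euc N :=
  (InnerProductSpace.toDual ℝ (Euc N)).symm (D.comp (ContinuousLinearMap.inl ℝ (Euc N) ℝ))

theorem inner_spatialGrad (D : (Euc N × ℝ) →L[ℝ] ℝ) (w : Euc N) :
    ⟪spatialGrad D, w⟫ = D (w, 0) := by
  unfold spatialGrad
  rw [InnerProductSpace.toDual_symm_apply]
  rfl

theorem pairCLM_spatialGrad (D : (Euc N × ℝ) →L[ℝ] ℝ) : pairCLM (spatialGrad D) (D (0, 1)) = D := by
  ext w
  · simp [pairCLM, inner_spatialGrad]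
  · simp [pairCLM]

theorem remainder_add_nonneg (hn : 0 ≤ n) {Λ : ℝ} (hΛ : 0 < Λ) (hε : 0 < ε) {u : Euc N × ℝ → ℝ}
    {z : Euc N × ℝ} (hu : 0 ≤ u z) :
    0 ≤ remainder p m q α s δ Λ n (cut γ n z) (u z + ε) :=
  remainder_nonneg hn (cut_nonneg n z) (by linarith) hΛ

theorem exists_pointwise_bound (P : Params p m q α s δ) {K : ℝ} (hK : 0 < K)
    (hγ : γ = p / (q - p - m + 2) * (q - 1)) :
    ∃ C, 0 < C ∧ ∀ (f : ℝ → ℝ) (u : Euc N × ℝ → ℝ) (g : Euc N) (τ n β ε Λ : ℝ) (z : Euc N × ℝ),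
      (∀ s : ℝ, 0 ≤ s → 0 ≤ f s ∧ f s ≤ K) → 1 ≤ n → 0 < β → 0 < ε → 0 < Λ → z ∈ Sset N →
      0 ≤ u z → HasFDerivAt u (pairCLM g τ) z → DifferentiableAt ℝ (cut γ n) z →
      DifferentiableAt ℝ (fun z : Euc N × ℝ => chi β z.2) z →
      fderiv ℝ (fun z => profile p m q α s n ε (chi β z.2, cut γ n z, u z)) z (g, 0) *
          u z ^ (m - 1) * ‖g‖ ^ (p - 2) * f ‖g‖ ≤
        C * errorDensity p m q α s δ γ Λ n β ε u z ∧
      -(fderiv ℝ (fun z => profile p m q α s n ε (chi β z.2, cut γ n z, u z)) z (0, 1) * u z +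
          fderiv ℝ (fun z => corrector p m q α s n ε (chi β z.2, cut γ n z, u z)) z (0, 1)) ≤
        C * errorDensity p m q α s δ γ Λ n β ε u z := by
  obtain ⟨C1, hC1, H1⟩ := exists_elliptic_bound P hK
  obtain ⟨C2, hC2, H2⟩ := exists_parabolic_bound P
  have P' := P
  obtain ⟨hp, hm, hq, hσ, hα, hα1, hαp, hασ, hs1, hs, hδ1, hδ2⟩ := P
  have hγ0 : 0 < γ := by
    rw [hγ]
    have : 0 < q - 1 := by linarith
    positivity
  refine ⟨C1 + C2, by positivity, ?_⟩
  intro f u g τ n β ε Λ z hf hn hβ hε hΛ hz hu0 hu hη hc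
  have hn0 : 0 < n := by linarith
  have hv : 0 < u z + ε := by linarith
  have D1 := (hasFDerivAt_profile (p := p) (m := m) (q := q) (α := α) (n := n) hs1
    hc.hasFDerivAt hη.hasFDerivAt hu hv).fderiv
  have D2 := (hasFDerivAt_corrector (p := p) (m := m) (q := q) (n := n) hs1 hα1
    hc.hasFDerivAt hη.hasFDerivAt hu hv).fderiv
  obtain ⟨hc1, hc2⟩ := fderiv_chi hβ hc.hasFDerivAt
  obtain ⟨hη1, hη2, hη3⟩ := fderiv_cut_bound hγ0 hn0 hz hη.hasFDerivAt
  have hχ0 := chi_nonneg β z.2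
  have hη0 := cut_nonneg (γ := γ) n z
  have hw := wt_nonneg (p := p) (m := m) (q := q) (α := α) (s := s) hn0.le hη0
  have hw' := wt'_nonneg P' hn hη0
  have hF := prim_nonneg hα1 hε hu0
  have hR := remainder_add_nonneg (p := p) (m := m) (q := q) (α := α) (s := s) (δ := δ)
    (γ := γ) hn0.le hΛ hε hu0
  have hG0 : 0 ≤ errorDensity p m q α s δ γ Λ n β ε u z := by
    unfold errorDensity
    refine indicator_apply_nonneg fun _ => mul_nonneg hχ0 hR
  have hfg := hf ‖g‖ (norm_nonneg g)
  have hgg : pairCLM g τ (g, 0) = ‖g‖ ^ 2 := by simp [pairCLM]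
  have hg1 : pairCLM g τ (0, 1) = τ := by simp [pairCLM]
  have E1 : fderiv ℝ (fun z => profile p m q α s n ε (chi β z.2, cut γ n z, u z)) z (g, 0) *
          u z ^ (m - 1) * ‖g‖ ^ (p - 2) * f ‖g‖ = chi β z.2 *
      (((s * cut γ n z ^ (s - 1) + wt' p m q α s n (cut γ n z) * (u z + ε) ^ (-α)) *
          fderiv ℝ (cut γ n) z (g, 0) -
        α * wt p m q α s n (cut γ n z) * (u z + ε) ^ (-α - 1) * ‖g‖ ^ 2) * u z ^ (m - 1) *
          ‖g‖ ^ (p - 2) * f ‖g‖) := by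
    rw [D1]
    simp only [add_apply, smul_apply, smul_eq_mul, hc1, hgg]
    ring
  have E2 : -(fderiv ℝ (fun z => profile p m q α s n ε (chi β z.2, cut γ n z, u z)) z (0, 1) * u z +
          fderiv ℝ (fun z => corrector p m q α s n ε (chi β z.2, cut γ n z, u z)) z (0, 1)) =
      -((cut γ n z ^ s * u z + wt p m q α s n (cut γ n z) * prim α ε (u z)) *
        fderiv ℝ (fun z : Euc N × ℝ => chi β z.2) z (0, 1)) +
      chi β z.2 * -((s * cut γ n z ^ (s - 1) * u z + wt' p m q α s n (cut γ n z) *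
        prim α ε (u z)) * fderiv ℝ (cut γ n) z (0, 1)) := by
    rw [D1, D2]
    simp only [add_apply, smul_apply, smul_eq_mul, hg1]
    ring
  rw [E1, E2]
  have T : -((cut γ n z ^ s * u z + wt p m q α s n (cut γ n z) * prim α ε (u z)) *
        fderiv ℝ (fun z : Euc N × ℝ => chi β z.2) z (0, 1)) ≤ 0 := by
    rw [neg_nonpos]; positivity
  rcases hη1 with hA | hA
  · have hG : errorDensity p m q α s δ γ Λ n β ε u z =
        chi β z.2 * remainder p m q α s δ Λ n (cut γ n z) (u z + ε) :=
      indicator_of_mem (s := annulus N γ n) hA _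
    rw [hG] at hG0 ⊢
    constructor
    · have := H1 n (cut γ n z) (u z + ε) (u z) ‖g‖ (f ‖g‖) (fderiv ℝ (cut γ n) z (g, 0)) Λ hn
        hA.1 hA.2.le hv hu0 (by linarith) (norm_nonneg _) hfg.1 hfg.2 hΛ (hη2 g)
      refine (mul_le_mul_of_nonneg_left this hχ0).trans ?_
      have := mul_nonneg hC2.le hG0
      linarith
    · have := H2 n (cut γ n z) (u z + ε) (u z) (prim α ε (u z)) (fderiv ℝ (cut γ n) z (0, 1)) Λ hn
        hA.1 hA.2.le hv hu0 (by linarith) hF (prim_le hα1 hε _) hΛ (by rw [← hγ]; exact hη3)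
      refine (add_le_add T (mul_le_mul_of_nonneg_left this hχ0)).trans ?_
      have := mul_nonneg hC1.le hG0
      linarith
  · rw [hA]
    have h0 : 0 ≤ (C1 + C2) * errorDensity p m q α s δ γ Λ n β ε u z := by positivity
    refine ⟨le_trans ?_ h0, le_trans ?_ h0⟩
    · have h1 : 0 ≤ α * wt p m q α s n (cut γ n z) * (u z + ε) ^ (-α - 1) * ‖g‖ ^ 2 := by positivity
      have h2 : 0 ≤ chi β z.2 * (u z ^ (m - 1) * ‖g‖ ^ (p - 2) * f ‖g‖) := by
        have := hfg.1
        positivity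
      rw [zero_apply, mul_zero, zero_sub]
      have := mul_nonneg h1 h2
      linarith
    · rw [zero_apply, mul_zero, neg_zero, mul_zero, add_zero]
      exact T

theorem continuousOn_chi (β : ℝ) : ContinuousOn (fun z : Euc N × ℝ => chi β z.2) (Sset N) :=
  ((locallyLipschitz_chi β).continuous.comp continuous_snd).continuousOn

theorem chi_mul_eq_zero_of_notMem_core (hγ : 0 < γ) (hn : 0 < n) (hβ : 0 < β) {z : Euc N × ℝ}
    (hz : z ∉ core N γ n β) : chi β z.2 = 0 ∨ cut γ n z = 0 := by
  by_contra h
  push Not at h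
  exact hz (mem_core hγ hn hβ h.1 h.2)

theorem integrable_errorDensity (P : Params p m q α s δ) (hγ : 0 < γ) (hn : 0 < n) (hβ : 0 < β)
    (ε Λ : ℝ) {a : Euc N → ℝ} (ha : Continuous a) {u : Euc N × ℝ → ℝ}
    (hu : ContinuousOn u (Sset N)) :
    Integrable (errorDensity p m q α s δ γ Λ n β ε u) (muS a) := by
  have := isLocallyFiniteMeasure_muS ha
  obtain ⟨hp, hm, hq, hσ, hα, hα1, hαp, hασ, hs1, hs, hδ1, hδ2⟩ := P
  have hcut := (locallyLipschitzOn_cut (N := N) hγ n).continuousOn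
  have hcont : ContinuousOn (fun z => chi β z.2 *
      remainder p m q α s δ Λ n (cut γ n z) (u z + ε)) (Sset N) := by
    refine (continuousOn_chi β).mul ?_
    unfold remainder
    have h1 : ContinuousOn (fun z => cut γ n z ^ s) (Sset N) :=
      hcut.rpow_const fun z _ => Or.inr (by linarith)
    have h2 : ContinuousOn (fun z => (u z + ε) ^ q) (Sset N) :=
      (hu.add continuousOn_const).rpow_const fun z _ => Or.inr (by linarith)
    fun_prop
  have h := (hcont.mono (core_subset hβ)).integrableOn_compact (μ := muS a)
    (isCompact_core (N := N) (γ := γ) (n := n) (β := β))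
  rw [← integrable_indicator_iff isCompact_core.isClosed.measurableSet] at h
  refine (h.indicator (measurableSet_annulus (γ := γ) (n := n))).congr (.of_forall fun z => ?_)
  unfold errorDensity
  by_cases hA : z ∈ annulus N γ n
  · rw [indicator_of_mem hA, indicator_of_mem hA]
    by_cases hz : z ∈ core N γ n β
    · rw [indicator_of_mem hz]
    · rw [indicator_of_notMem hz,
        (chi_mul_eq_zero_of_notMem_core hγ hn hβ hz).resolve_right hA.1.ne', zero_mul]
  · rw [indicator_of_notMem hA, indicator_of_notMem hA]

end

section

variable {N : ℕ} {p m q α s δ ε γ n β : ℝ}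

/-- The test function inequality with all error terms collected in `errorDensity`. -/
theorem exists_energy_bound (P : Params p m q α s δ) {K : ℝ} (hK : 0 < K)
    (hγ : γ = p / (q - p - m + 2) * (q - 1)) :
    ∃ C, 0 < C ∧ ∀ (f : ℝ → ℝ) (a : Euc N → ℝ) (u : Euc N × ℝ → ℝ) (gu : Euc N × ℝ → Euc N)
      (ut : Euc N × ℝ → ℝ), (∀ s : ℝ, 0 ≤ s → 0 ≤ f s ∧ f s ≤ K) → Continuous a →
      IsWeakSol N p m q (fun _ => 1) f a u gu ut → ∀ n β ε Λ : ℝ, 1 ≤ n → 0 < β → 0 < ε → 0 < Λ →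
      ∫ z, chi β z.2 * (cut γ n z ^ s * u z ^ q) ∂muS a ≤
        C * ∫ z, errorDensity p m q α s δ γ Λ n β ε u z ∂muS a := by
  obtain ⟨C, hC, H⟩ := exists_pointwise_bound (N := N) P hK hγ
  refine ⟨C + C, by positivity, ?_⟩
  intro f a u gu ut hf ha hu n β ε Λ hn hβ hε hΛ
  have P' := P
  obtain ⟨hp, hm, hq, hσ, hα, hα1, hαp, hασ, hs1, hs, hδ1, hδ2⟩ := P
  have hγ0 : 0 < γ := by
    rw [hγ]
    have : 0 < q - 1 := by linarith
    positivity
  have hn0 : 0 < n := by linarith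
  have hu0 := hu.nonneg
  have hcu := hu.locLip.continuousOn
  have hS := core_subset (N := N) (γ := γ) (n := n) hβ
  set ψ : Euc N × ℝ → ℝ :=
    fun z => profile p m q α s n ε (chi β z.2, cut γ n z, u z) with hψ
  set Q : Euc N × ℝ → ℝ :=
    fun z => corrector p m q α s n ε (chi β z.2, cut γ n z, u z) with hQ
  obtain ⟨ψlip, ψc, ψs⟩ := testFun_regular hγ0 hn0 hβ (G := profile p m q α s n ε)
    (contDiffAt_profile hs1 hε) (fun η v => by simp [profile])
    (fun c v => by simp [profile, wt_zero hs1, zero_rpow (show s ≠ 0 by linarith)]) hu.locLip hu0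
  obtain ⟨Qlip, Qc, Qs⟩ := testFun_regular hγ0 hn0 hβ (G := corrector p m q α s n ε)
    (contDiffAt_corrector hs1 hε) (fun η v => by simp [corrector])
    (fun c v => by simp [corrector, wt_zero hs1]) hu.locLip hu0
  have hψge : ∀ z, chi β z.2 * cut γ n z ^ s ≤ ψ z := by
    intro z
    by_cases hz : z ∈ core N γ n β
    · have h1 := hu0 z (hS hz)
      have h2 : 0 ≤ wt p m q α s n (cut γ n z) * (u z + ε) ^ (-α) :=
        mul_nonneg (wt_nonneg hn0.le (cut_nonneg n z)) (by positivity)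
      exact mul_le_mul_of_nonneg_left (by simp only; linarith) (chi_nonneg β z.2)
    · rcases chi_mul_eq_zero_of_notMem_core hγ0 hn0 hβ hz with h | h
      · simp [hψ, profile, h]
      · simp [hψ, profile, h, wt_zero hs1, zero_rpow (show s ≠ 0 by linarith)]
  have hψ0 : ∀ z, 0 ≤ ψ z := fun z =>
    (mul_nonneg (chi_nonneg β z.2) (rpow_nonneg (cut_nonneg n z) s)).trans (hψge z)
  have weak := hu.weak_ineq ψ (fun z => spatialGrad (fderiv ℝ ψ z)) (fun z => fderiv ℝ ψ z (0, 1))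
    hψ0 ψlip ψc (ψs.trans hS) (Eventually.of_forall fun z hz => by
      rw [pairCLM_spatialGrad]; exact hz.hasFDerivAt)
  have hcut := (locallyLipschitzOn_cut (N := N) hγ0 n).continuousOn
  have huq : ContinuousOn (fun z => u z ^ q) (Sset N) :=
    hcu.rpow_const fun z _ => Or.inr (by linarith)
  have hcs : ContinuousOn (fun z => cut γ n z ^ s) (Sset N) :=
    hcut.rpow_const fun z _ => Or.inr (by linarith)
  have I1 : Integrable (fun z => chi β z.2 * (cut γ n z ^ s * u z ^ q)) (muS a) := by
    refine integrable_of_continuousOn_of_core (γ := γ) (n := n) ha hβ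
      ((continuousOn_chi β).mul (hcs.mul huq)) fun z hz => ?_
    rcases chi_mul_eq_zero_of_notMem_core hγ0 hn0 hβ hz with h | h
    · rw [h, zero_mul]
    · rw [h, zero_rpow (by linarith), zero_mul, mul_zero]
  have I2 : Integrable (fun z => ψ z * u z ^ q * 1) (muS a) := by
    refine integrable_of_continuousOn_of_core (γ := γ) (n := n) ha hβ
      ((ψlip.continuous.continuousOn.mul huq).mul continuousOn_const) fun z hz => ?_
    have : ψ z = 0 := by
      by_contra h
      exact hz (ψs (subset_tsupport _ h))
    rw [this, zero_mul, zero_mul]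
  have I3 := integrable_errorDensity P' hγ0 hn0 hβ ε Λ ha hcu
  have I4 := integrable_fderiv_mul ha hβ ψlip ψc ψs hcu (0, 1)
  have I5 := integrable_fderiv_mul ha hβ Qlip Qc Qs
    (continuousOn_const (c := (1 : ℝ))) (0, 1)
  simp only [mul_one] at I5
  have hAC := muS_absolutelyContinuous (N := N) ha
  have hχl : LocallyLipschitzOn (Sset N) (fun z : Euc N × ℝ => chi β z.2) := by
    have : LocallyLipschitz (fun z : Euc N × ℝ => chi β z.2) :=
      (locallyLipschitz_chi β).comp LipschitzWith.prod_snd.locallyLipschitz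
    exact this.locallyLipschitzOn
  have hae : ∀ᵐ z ∂muS a,
      fderiv ℝ ψ z (gu z, 0) * u z ^ (m - 1) * ‖gu z‖ ^ (p - 2) * f ‖gu z‖ ≤
        C * errorDensity p m q α s δ γ Λ n β ε u z ∧
      -(fderiv ℝ ψ z (0, 1) * u z + fderiv ℝ Q z (0, 1)) ≤
        C * errorDensity p m q α s δ γ Λ n β ε u z := by
    filter_upwards [ae_mem_Sset ha, hAC.ae_le hu.deriv_ae,
      hAC.ae_le (hu.locLip.ae_differentiableAt (μ := volume) (isOpen_Sset N)),
      hAC.ae_le ((locallyLipschitzOn_cut hγ0 n).ae_differentiableAt (μ := volume) (isOpen_Sset N)),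
      hAC.ae_le (hχl.ae_differentiableAt (μ := volume) (isOpen_Sset N))] with z hz h1 h2 h3 h4
    exact H f u (gu z) (ut z) n β ε Λ z hf hn hβ hε hΛ hz (hu0 z hz) (h1 h2) h3 h4
  have hG0 : 0 ≤ ∫ z, errorDensity p m q α s δ γ Λ n β ε u z ∂muS a := by
    refine integral_nonneg_of_ae ?_
    filter_upwards [ae_mem_Sset ha] with z hz
    exact indicator_apply_nonneg fun _ =>
      mul_nonneg (chi_nonneg _ _) (remainder_add_nonneg hn0.le hΛ hε (hu0 z hz))
  have B1 : ∫ z, ⟪spatialGrad (fderiv ℝ ψ z), gu z⟫ * u z ^ (m - 1) * ‖gu z‖ ^ (p - 2) *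
      f ‖gu z‖ ∂muS a ≤ C * ∫ z, errorDensity p m q α s δ γ Λ n β ε u z ∂muS a := by
    simp only [inner_spatialGrad]
    rw [← integral_const_mul]
    by_cases hPa : Integrable (fun z => fderiv ℝ ψ z (gu z, 0) * u z ^ (m - 1) *
        ‖gu z‖ ^ (p - 2) * f ‖gu z‖) (muS a)
    · exact integral_mono_ae hPa (I3.const_mul C) (hae.mono fun z h => h.1)
    · rw [integral_undef hPa, integral_const_mul]
      positivity
  have B2 : -∫ z, fderiv ℝ ψ z (0, 1) * u z ∂muS a ≤
      C * ∫ z, errorDensity p m q α s δ γ Λ n β ε u z ∂muS a := by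
    have h0 := integral_fderiv_time_muS ha Qlip Qc (Qs.trans hS)
    have h1 : -∫ z, fderiv ℝ ψ z (0, 1) * u z ∂muS a =
        ∫ z, -(fderiv ℝ ψ z (0, 1) * u z + fderiv ℝ Q z (0, 1)) ∂muS a := by
      rw [integral_neg, integral_add I4 I5, h0, add_zero]
    rw [h1, ← integral_const_mul]
    exact integral_mono_ae (I4.add I5).neg (I3.const_mul C) (hae.mono fun z h => h.2)
  have B3 : ∫ z, chi β z.2 * (cut γ n z ^ s * u z ^ q) ∂muS a ≤
      ∫ z, ψ z * u z ^ q * 1 ∂muS a := by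
    refine integral_mono_ae I1 I2 ?_
    filter_upwards [ae_mem_Sset ha] with z hz
    have h1 := hu0 z hz
    have h2 := mul_le_mul_of_nonneg_right (hψge z) (rpow_nonneg h1 q)
    linarith
  linarith

end

section

variable {N : ℕ} {p m q α s δ ε γ n β : ℝ}

theorem muS_shell_le {a : Euc N → ℝ} (hγ : 0 < γ) (r : ℝ) :
    muS a {z | z ∈ Sset N ∧ logGauge γ z ≤ r} ≤
      muA a (ball 0 (exp (r + 1))) * ENNReal.ofReal (exp (γ * r)) := by
  have hsub : {z | z ∈ Sset N ∧ logGauge γ z ≤ r} ⊆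
      ball (0 : Euc N) (exp (r + 1)) ×ˢ Iic (exp (γ * r)) := by
    rintro z ⟨hz, hr⟩
    refine ⟨?_, (time_le_exp_gauge hγ hz).trans (by gcongr)⟩
    rw [mem_ball_zero_iff]
    exact (norm_le_exp_gauge hγ hz).trans_lt (by gcongr; linarith)
  refine (measure_mono hsub).trans ?_
  unfold muS muA
  rw [Measure.prod_prod]
  gcongr
  rw [Measure.restrict_apply measurableSet_Iic, inter_comm, Ioi_inter_Iic, Real.volume_Ioc,
    sub_zero]

theorem exists_lintegral_annulus_le (hσ : 0 < q - p - m + 2) (hp : 1 < p) (hq : 1 < q) (hδ : 0 ≤ δ)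
    (hγ : γ = p / (q - p - m + 2) * (q - 1)) {a : Euc N → ℝ} {C : ℝ} (hC : 0 < C)
    (hS : ∀ᵐ z ∂muS a, z ∈ Sset N)
    (hvol : ∃ R1 : ℝ, 1 < R1 ∧ ∀ R, R1 ≤ R → muA a (Metric.ball (0 : Euc N) R) ≤
        ENNReal.ofReal (C * R ^ (p / (q - p - m + 2)) * Real.log R ^ δ)) :
    ∃ D : ℝ, 0 < D ∧ ∃ n₀ : ℕ, 1 ≤ n₀ ∧ ∀ n : ℕ, n₀ ≤ n →
      ∫⁻ z in annulus N γ n, ENNReal.ofReal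
        (exp (-(p / (q - p - m + 2) * q * (n * (2 - cut γ n z))))) ∂muS a ≤
      ENNReal.ofReal (D * (n : ℝ) ^ (1 + δ)) := by
  obtain ⟨R1, hR1, hvol⟩ := hvol
  set e := p / (q - p - m + 2) with he
  have he0 : 0 < e := by positivity
  have hγ0 : 0 < γ := by
    rw [hγ]
    have : 0 < q - 1 := by linarith
    positivity
  refine ⟨C * exp (2 * e + γ) * 3 ^ δ, by positivity, max 1 ⌈R1⌉₊, le_max_left _ _, ?_⟩
  intro n hn
  have hn1 : 1 ≤ n := (le_max_left _ _).trans hn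
  have hn1' : (1 : ℝ) ≤ n := by exact_mod_cast hn1
  have hnR : R1 ≤ n := (Nat.le_ceil R1).trans (by exact_mod_cast (le_max_right _ _).trans hn)
  let T : ℕ → Set (Euc N × ℝ) := fun k =>
    {z | z ∈ Sset N ∧ logGauge γ z ≤ (n + k : ℕ) + 1}
  let c : ℕ → ℝ≥0∞ := fun k => ENNReal.ofReal (exp (-(e * q * (n + k : ℕ))))
  have hT : ∀ k, MeasurableSet (T k) := fun k =>
    (isOpen_Sset N).measurableSet.inter (measurableSet_le measurable_gauge measurable_const)
  have hmeas : ∀ k, k < n → c k * muS a (T k) ≤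
      ENNReal.ofReal (C * exp (2 * e + γ) * 3 ^ δ * (n : ℝ) ^ δ) := by
    intro k hk
    have hk' : (k : ℝ) + 1 ≤ n := by exact_mod_cast hk
    set j : ℝ := ((n + k : ℕ) : ℝ) with hj
    have hj' : j = n + k := by rw [hj]; push_cast; ring
    have hk0 : (0 : ℝ) ≤ k := Nat.cast_nonneg k
    have h1 := hvol (exp (j + 1 + 1)) (by
      have := Real.add_one_le_exp (j + 1 + 1)
      linarith)
    have h2 := muS_shell_le (a := a) hγ0 (j + 1)
    calc c k * muS a (T k)
        ≤ c k * (ENNReal.ofReal (C * exp (j + 1 + 1) ^ e * Real.log (exp (j + 1 + 1)) ^ δ) *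
            ENNReal.ofReal (exp (γ * (j + 1)))) := by
          gcongr
          exact h2.trans (by gcongr)
      _ = ENNReal.ofReal (exp (-(e * q * j)) * (C * exp (j + 1 + 1) ^ e *
            Real.log (exp (j + 1 + 1)) ^ δ * exp (γ * (j + 1)))) := by
          have hl : 0 ≤ Real.log (exp (j + 1 + 1)) := by rw [Real.log_exp]; linarith
          rw [← ENNReal.ofReal_mul (by positivity), ← ENNReal.ofReal_mul (by positivity)]
      _ ≤ _ := by
          apply ENNReal.ofReal_le_ofReal
          rw [Real.log_exp, ← Real.exp_mul]
          have h3 : exp (-(e * q * j)) * (C * exp ((j + 1 + 1) * e) * (j + 1 + 1) ^ δ *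
              exp (γ * (j + 1))) = C * exp (2 * e + γ) * (j + 1 + 1) ^ δ := by
            have h4 : exp (2 * e + γ) =
                exp (-(e * q * j)) * exp ((j + 1 + 1) * e) * exp (γ * (j + 1)) := by
              rw [← Real.exp_add, ← Real.exp_add, hγ]; congr 1; ring
            rw [h4]; ring
          rw [h3, mul_assoc _ ((3 : ℝ) ^ δ), ← mul_rpow (by norm_num) (by linarith)]
          gcongr
          linarith
  have hle : ∀ᵐ z ∂muS a, (annulus N γ n).indicator (fun z => ENNReal.ofReal
      (exp (-(e * q * (n * (2 - cut γ n z)))))) z ≤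
      ∑ k ∈ Finset.range n, (T k).indicator (fun _ => c k) z := by
    filter_upwards [hS] with z hz
    by_cases hA : z ∈ annulus N γ n
    swap
    · rw [indicator_of_notMem hA]; exact zero_le
    rw [indicator_of_mem hA, ← gauge_eq_of_cut (by linarith) hA.1 hA.2]
    have g1 := lt_gauge_of_cut_lt_one (by linarith) hA.2
    have g2 := gauge_lt_of_cut_pos (by linarith) hA.1
    have g0 : 0 ≤ logGauge γ z := by linarith
    obtain ⟨k, hk⟩ := Nat.exists_eq_add_of_le (Nat.le_floor g1.le)
    have hkn : k < n := by
      have : ⌊logGauge γ z⌋₊ < 2 * n := (Nat.floor_lt g0).2 (by exact_mod_cast g2)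
      omega
    have hzT : z ∈ T k := ⟨hz, by rw [← hk]; exact (Nat.lt_floor_add_one _).le⟩
    refine le_trans ?_ (Finset.single_le_sum (f := fun k => (T k).indicator (fun _ => c k) z)
      (fun _ _ => zero_le) (Finset.mem_range.2 hkn))
    simp only [indicator_of_mem hzT]
    apply ENNReal.ofReal_le_ofReal
    have := Nat.floor_le g0
    rw [← hk]
    gcongr
  rw [← lintegral_indicator measurableSet_annulus]
  refine (lintegral_mono_ae hle).trans ?_
  rw [lintegral_finsetSum _ fun k _ => (measurable_const.indicator (hT k))]
  calc ∑ k ∈ Finset.range n, ∫⁻ z, (T k).indicator (fun _ => c k) z ∂muS a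
      = ∑ k ∈ Finset.range n, c k * muS a (T k) := by
        refine Finset.sum_congr rfl fun k _ => lintegral_indicator_const (hT k) _
    _ ≤ ∑ _k ∈ Finset.range n, ENNReal.ofReal (C * exp (2 * e + γ) * 3 ^ δ * (n : ℝ) ^ δ) :=
        Finset.sum_le_sum fun k hk => hmeas k (Finset.mem_range.1 hk)
    _ = _ := by
        rw [Finset.sum_const, Finset.card_range, nsmul_eq_mul, ← ENNReal.ofReal_natCast,
          ← ENNReal.ofReal_mul (by positivity), rpow_one_add' (by positivity) (by positivity)]
        congr 1; ring

end

section

variable {N : ℕ} {p m q α s δ ε γ n β : ℝ}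

theorem integrable_cutoff_mul (hγ : 0 < γ) (hn : 0 < n) (hβ : 0 < β) (hs : 0 < s)
    {a : Euc N → ℝ} (ha : Continuous a) {w : Euc N × ℝ → ℝ} (hw : ContinuousOn w (Sset N)) :
    Integrable (fun z => chi β z.2 * (cut γ n z ^ s * w z)) (muS a) := by
  have hcs : ContinuousOn (fun z => cut γ n z ^ s) (Sset N) :=
    (locallyLipschitzOn_cut hγ n).continuousOn.rpow_const fun z _ => Or.inr hs.le
  refine integrable_of_continuousOn_of_core (γ := γ) (n := n) ha hβ
    ((continuousOn_chi β).mul (hcs.mul hw)) fun z hz => ?_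
  rcases chi_mul_eq_zero_of_notMem_core hγ hn hβ hz with h | h
  · rw [h, zero_mul]
  · rw [h, zero_rpow hs.ne', zero_mul, mul_zero]

theorem exists_absorption_ineq (P : Params p m q α s δ) (hδ : 0 ≤ δ) {K : ℝ} (hK : 0 < K)
    (hγ : γ = p / (q - p - m + 2) * (q - 1)) {a : Euc N → ℝ} (ha : Continuous a) {C : ℝ}
    (hC : 0 < C) (hvol : ∃ R1 : ℝ, 1 < R1 ∧ ∀ R, R1 ≤ R → muA a (Metric.ball (0 : Euc N) R) ≤
        ENNReal.ofReal (C * R ^ (p / (q - p - m + 2)) * Real.log R ^ δ))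
    {f : ℝ → ℝ} (hf : ∀ s : ℝ, 0 ≤ s → 0 ≤ f s ∧ f s ≤ K) {u : Euc N × ℝ → ℝ}
    {gu : Euc N × ℝ → Euc N} {ut : Euc N × ℝ → ℝ}
    (hu : IsWeakSol N p m q (fun _ => 1) f a u gu ut) :
    ∃ B : ℝ, 0 < B ∧ ∃ n₀ : ℕ, 1 ≤ n₀ ∧ ∀ n : ℕ, n₀ ≤ n → ∀ β Λ : ℝ, 0 < β → 0 < Λ →
      ∫ z, chi β z.2 * (cut γ n z ^ s * u z ^ q) ∂muS a ≤
        B * Λ * (∫ z in annulus N γ n, chi β z.2 * (cut γ n z ^ s * u z ^ q) ∂muS a) +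
          B * decay p m q α Λ := by
  obtain ⟨A, hA, hen⟩ := exists_energy_bound (N := N) P hK hγ
  have P' := P
  obtain ⟨hp, hm, hq, hσ, hα, hα1, hαp, hασ, hs1, hs, hδ1, hδ2⟩ := P
  have hγ0 : 0 < γ := by
    rw [hγ]
    have : 0 < q - 1 := by linarith
    positivity
  obtain ⟨D, hD, n₀, hn₀, hvol⟩ := exists_lintegral_annulus_le hσ hp hq hδ hγ hC
    (ae_mem_Sset ha) hvol
  refine ⟨A * 2 ^ (q - 1) + A * D, by positivity, n₀, hn₀, ?_⟩
  intro n hn β Λ hβ hΛ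
  have hn1 : (1 : ℝ) ≤ n := by exact_mod_cast hn₀.trans hn
  have hn0 : (0 : ℝ) < n := by linarith
  have hu0 := hu.nonneg
  have hcu := hu.locLip.continuousOn
  have hdec := decay_nonneg (p := p) (m := m) (q := q) (α := α) hΛ
  have huq : ContinuousOn (fun z => u z ^ q) (Sset N) :=
    hcu.rpow_const fun z _ => Or.inr (by linarith)
  have I1 := (integrable_cutoff_mul hγ0 hn0 hβ (by linarith : 0 < s) ha huq).integrableOn
    (s := annulus N γ n)
  have I2 := (integrable_cutoff_mul hγ0 hn0 hβ (by linarith : 0 < s) ha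
    (continuousOn_const (c := (1 : ℝ)))).integrableOn (s := annulus N γ n)
  set E : Euc N × ℝ → ℝ := fun z => exp (-(p / (q - p - m + 2) * q * (n * (2 - cut γ n z)))) with hE
  have hEmeas : Measurable E := by
    have := measurable_cut (N := N) (γ := γ) n
    fun_prop
  have hEle := hvol n hn
  have I3 : IntegrableOn E (annulus N γ n) (muS a) := by
    refine ⟨hEmeas.aestronglyMeasurable, ?_⟩
    rw [hasFiniteIntegral_iff_ofReal (Eventually.of_forall fun z => (exp_pos _).le)]
    exact hEle.trans_lt ENNReal.ofReal_lt_top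
  have hEint : ∫ z in annulus N γ n, E z ∂muS a ≤ D * (n : ℝ) ^ (1 + δ) := by
    rw [integral_eq_lintegral_of_nonneg_ae (Eventually.of_forall fun z => (exp_pos _).le)
      hEmeas.aestronglyMeasurable]
    exact ENNReal.toReal_le_of_le_ofReal (by positivity) hEle
  set Y := ∫ z, chi β z.2 * (cut γ n z ^ s * u z ^ q) ∂muS a with hY
  set Z := ∫ z in annulus N γ n, chi β z.2 * (cut γ n z ^ s * u z ^ q) ∂muS a with hZ
  set M := ∫ z in annulus N γ n, chi β z.2 * (cut γ n z ^ s * 1) ∂muS a with hM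
  have hZ0 : 0 ≤ Z := by
    refine integral_nonneg_of_ae (ae_restrict_of_ae ?_)
    filter_upwards [ae_mem_Sset ha] with z hz
    exact mul_nonneg (chi_nonneg _ _) (mul_nonneg (rpow_nonneg (cut_nonneg _ _) _)
      (rpow_nonneg (hu0 z hz) _))
  have key : ∀ ε : ℝ, 0 < ε →
      Y ≤ A * (Λ * 2 ^ (q - 1) * Z + decay p m q α Λ * D) + A * (Λ * 2 ^ (q - 1) * M) * ε ^ q := by
    intro ε hε
    have h1 := hen f a u gu ut hf ha hu n β ε Λ hn1 hβ hε hΛ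
    have I4 := integrable_errorDensity P' hγ0 hn0 hβ ε Λ ha hcu
    unfold errorDensity at h1 I4
    rw [integral_indicator measurableSet_annulus] at h1
    rw [integrable_indicator_iff measurableSet_annulus] at I4
    have h2 : ∫ z in annulus N γ n, chi β z.2 *
        remainder p m q α s δ Λ n (cut γ n z) (u z + ε) ∂muS a ≤
        ∫ z in annulus N γ n, (Λ * 2 ^ (q - 1)) * (chi β z.2 * (cut γ n z ^ s * u z ^ q)) +
          (Λ * 2 ^ (q - 1) * ε ^ q) * (chi β z.2 * (cut γ n z ^ s * 1)) +
          (decay p m q α Λ * (n : ℝ) ^ (-(1 + δ))) * E z ∂muS a := by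
      refine integral_mono_ae I4 (((I1.const_mul _).add (I2.const_mul _)).add (I3.const_mul _))
        (ae_restrict_of_ae ?_)
      filter_upwards [ae_mem_Sset ha] with z hz
      have hχ0 := chi_nonneg β z.2
      have hχ1 := chi_le_one β z.2
      have h3 : (u z + ε) ^ q ≤ 2 ^ (q - 1) * (u z ^ q + ε ^ q) :=
        mod_cast NNReal.rpow_add_le_mul_rpow_add_rpow ⟨u z, hu0 z hz⟩ ⟨ε, hε.le⟩ hq.le
      have h4 : 0 ≤ cut γ n z ^ s := rpow_nonneg (cut_nonneg _ _) _
      have h5 : 0 ≤ (decay p m q α Λ * (n : ℝ) ^ (-(1 + δ))) * E z := by positivity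
      unfold remainder
      calc chi β z.2 * (Λ * (cut γ n z ^ s * (u z + ε) ^ q) + decay p m q α Λ *
            ((n : ℝ) ^ (-(1 + δ)) * E z))
          ≤ chi β z.2 * (Λ * (cut γ n z ^ s * (2 ^ (q - 1) * (u z ^ q + ε ^ q)))) +
            1 * ((decay p m q α Λ * (n : ℝ) ^ (-(1 + δ))) * E z) := by
            rw [mul_add, ← mul_assoc (decay p m q α Λ)]
            gcongr
        _ = _ := by ring
    have h6 := (I1.const_mul (Λ * 2 ^ (q - 1))).add (I2.const_mul (Λ * 2 ^ (q - 1) * ε ^ q))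
    simp only [Pi.add_def] at h6
    rw [integral_add h6 (I3.const_mul _), integral_add (I1.const_mul _) (I2.const_mul _),
      integral_const_mul, integral_const_mul,
      integral_const_mul] at h2
    have h3 : decay p m q α Λ * (n : ℝ) ^ (-(1 + δ)) * ∫ z in annulus N γ n, E z ∂muS a ≤
        decay p m q α Λ * D := by
      calc _ ≤ decay p m q α Λ * (n : ℝ) ^ (-(1 + δ)) * (D * (n : ℝ) ^ (1 + δ)) := by gcongr
        _ = decay p m q α Λ * D * ((n : ℝ) ^ (-(1 + δ)) * (n : ℝ) ^ (1 + δ)) := by ring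
        _ = _ := by rw [← rpow_add hn0, neg_add_cancel, rpow_zero, mul_one]
    have h4 := mul_le_mul_of_nonneg_left (h2.trans (add_le_add_right h3 _)) hA.le
    refine h1.trans (h4.trans (le_of_eq ?_))
    ring
  have lim : Tendsto (fun ε : ℝ => A * (Λ * 2 ^ (q - 1) * Z + decay p m q α Λ * D) +
      A * (Λ * 2 ^ (q - 1) * M) * ε ^ q) (𝓝[>] 0)
      (𝓝 (A * (Λ * 2 ^ (q - 1) * Z + decay p m q α Λ * D) +
        A * (Λ * 2 ^ (q - 1) * M) * 0 ^ q)) := by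
    have : Tendsto (fun ε : ℝ => ε ^ q) (𝓝[>] 0) (𝓝 (0 ^ q)) :=
      ((Real.continuousAt_rpow_const 0 q (Or.inr (by linarith))).tendsto).mono_left
        nhdsWithin_le_nhds
    exact tendsto_const_nhds.add (tendsto_const_nhds.mul this)
  have fin := ge_of_tendsto lim (eventually_mem_nhdsWithin.mono key)
  rw [zero_rpow (by linarith), mul_zero, add_zero] at fin
  have e1 : 0 ≤ A * D * (Λ * Z) := by positivity
  have e2 : 0 ≤ A * 2 ^ (q - 1) * decay p m q α Λ := by positivity
  linarith

/-- The reverse-type inequality of `exists_absorption_ineq` for lower Lebesgue integrals. -/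
theorem exists_absorption_ineq_lintegral (P : Params p m q α s δ) (hδ : 0 ≤ δ) {K : ℝ} (hK : 0 < K)
    (hγ : γ = p / (q - p - m + 2) * (q - 1)) {a : Euc N → ℝ} (ha : Continuous a) {C : ℝ}
    (hC : 0 < C) (hvol : ∃ R1 : ℝ, 1 < R1 ∧ ∀ R, R1 ≤ R → muA a (Metric.ball (0 : Euc N) R) ≤
        ENNReal.ofReal (C * R ^ (p / (q - p - m + 2)) * Real.log R ^ δ))
    {f : ℝ → ℝ} (hf : ∀ s : ℝ, 0 ≤ s → 0 ≤ f s ∧ f s ≤ K) {u : Euc N × ℝ → ℝ}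
    {gu : Euc N × ℝ → Euc N} {ut : Euc N × ℝ → ℝ}
    (hu : IsWeakSol N p m q (fun _ => 1) f a u gu ut) :
    ∃ B : ℝ, 0 < B ∧ ∃ n₀ : ℕ, 1 ≤ n₀ ∧ ∀ n : ℕ, n₀ ≤ n → ∀ β Λ : ℝ, 0 < β → 0 < Λ →
      ∃ y z : ℝ, y ≤ B * Λ * z + B * decay p m q α Λ ∧ 0 ≤ z ∧ z ≤ y ∧
        ∫⁻ z in {z | z ∈ Sset N ∧ logGauge γ z ≤ n ∧ 2 * β ≤ z.2}, ENNReal.ofReal (u z ^ q) ∂muS a ≤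
          ENNReal.ofReal y ∧
        ENNReal.ofReal z ≤ ∫⁻ z in annulus N γ n, ENNReal.ofReal (u z ^ q) ∂muS a := by
  obtain ⟨B, hB, n₀, hn₀, H⟩ := exists_absorption_ineq P hδ hK hγ ha hC hvol hf hu
  obtain ⟨hp, hm, hq, hσ, hα, hα1, hαp, hασ, hs1, hs, hδ1, hδ2⟩ := P
  have hγ0 : 0 < γ := by
    rw [hγ]
    have : 0 < q - 1 := by linarith
    positivity
  refine ⟨B, hB, n₀, hn₀, fun n hn β Λ hβ hΛ => ⟨_, _, H n hn β Λ hβ hΛ, ?_⟩⟩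
  have hn0 : (0 : ℝ) < n := by exact_mod_cast hn₀.trans hn
  have hu0 := hu.nonneg
  have huq : ContinuousOn (fun z => u z ^ q) (Sset N) :=
    hu.locLip.continuousOn.rpow_const fun z _ => Or.inr (by linarith)
  have I1 := integrable_cutoff_mul hγ0 hn0 hβ (by linarith : 0 < s) ha huq
  have hpos : ∀ᵐ z ∂muS a, 0 ≤ chi β z.2 * (cut γ n z ^ s * u z ^ q) := by
    filter_upwards [ae_mem_Sset ha] with z hz
    exact mul_nonneg (chi_nonneg _ _) (mul_nonneg (rpow_nonneg (cut_nonneg _ _) _)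
      (rpow_nonneg (hu0 z hz) _))
  refine ⟨integral_nonneg_of_ae (ae_restrict_of_ae hpos),
    setIntegral_le_integral I1 hpos, ?_, ?_⟩
  · rw [ofReal_integral_eq_lintegral_ofReal I1 hpos]
    have hmeas : MeasurableSet {z : Euc N × ℝ | z ∈ Sset N ∧ logGauge γ z ≤ n ∧ 2 * β ≤ z.2} :=
      (isOpen_Sset N).measurableSet.inter
        ((measurableSet_le measurable_gauge measurable_const).inter
        (measurableSet_le measurable_const measurable_snd))
    rw [← lintegral_indicator hmeas]
    refine lintegral_mono fun z => ?_
    by_cases hz : z ∈ {z : Euc N × ℝ | z ∈ Sset N ∧ logGauge γ z ≤ n ∧ 2 * β ≤ z.2}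
    · rw [indicator_of_mem hz, chi_eq_one hβ hz.2.2, cut_eq_one hn0 hz.2.1, one_rpow, one_mul,
        one_mul]
    · rw [indicator_of_notMem hz]
      exact zero_le
  · rw [ofReal_integral_eq_lintegral_ofReal I1.integrableOn (ae_restrict_of_ae hpos)]
    refine lintegral_mono_ae (ae_restrict_of_ae ?_)
    filter_upwards [ae_mem_Sset ha] with z hz
    apply ENNReal.ofReal_le_ofReal
    have h1 := rpow_nonneg (hu0 z hz) q
    have h2 : cut γ n z ^ s ≤ 1 := rpow_le_one (cut_nonneg _ _) (cut_le_one _ _) (by linarith)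
    have h3 := rpow_nonneg (cut_nonneg (γ := γ) n z) s
    calc _ ≤ 1 * (1 * u z ^ q) := by
          gcongr
          exact chi_le_one _ _
      _ = _ := by ring

end

section

variable {N : ℕ} {p m q α s δ γ : ℝ}

theorem measure_le_of_forall_exhaustion {X : Type*} [MeasurableSpace X] {ν : Measure X}
    {W : ℕ → Set X} {S : Set X} (hmono : Monotone W) (hW : ⋃ k, W k = S) (hS : ν Sᶜ = 0) {b : ℝ≥0∞}
    (h : ∀ k, ν (W k) ≤ b) : ν univ ≤ b := by
  calc ν univ ≤ ν S + ν Sᶜ := by rw [← union_compl_self S]; exact measure_union_le _ _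
    _ = ⨆ k, ν (W k) := by rw [hS, add_zero, ← hW, hmono.measure_iUnion]
    _ ≤ b := iSup_le h

theorem lintegral_rpow_eq_zero (P : Params p m q α s δ) (hδ : 0 ≤ δ) {K : ℝ} (hK : 0 < K)
    (hγ : γ = p / (q - p - m + 2) * (q - 1)) {a : Euc N → ℝ} (ha : Continuous a) {C : ℝ}
    (hC : 0 < C) (hvol : ∃ R1 : ℝ, 1 < R1 ∧ ∀ R, R1 ≤ R → muA a (Metric.ball (0 : Euc N) R) ≤
        ENNReal.ofReal (C * R ^ (p / (q - p - m + 2)) * Real.log R ^ δ))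
    {f : ℝ → ℝ} (hf : ∀ s : ℝ, 0 ≤ s → 0 ≤ f s ∧ f s ≤ K) {u : Euc N × ℝ → ℝ}
    {gu : Euc N × ℝ → Euc N} {ut : Euc N × ℝ → ℝ}
    (hu : IsWeakSol N p m q (fun _ => 1) f a u gu ut) :
    ∫⁻ z, ENNReal.ofReal (u z ^ q) ∂muS a = 0 := by
  obtain ⟨B, hB, n₀, hn₀, H⟩ := exists_absorption_ineq_lintegral P hδ hK hγ ha hC hvol hf hu
  set ν := (muS a).withDensity (fun z => ENNReal.ofReal (u z ^ q)) with hν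
  set W : ℕ → Set (Euc N × ℝ) := fun k =>
    {z | z ∈ Sset N ∧ logGauge γ z ≤ (n₀ + k : ℕ) ∧ 2 * (1 / ((k : ℝ) + 1)) ≤ z.2} with hWdef
  have hWmeas : ∀ k, MeasurableSet (W k) := fun k =>
    (isOpen_Sset N).measurableSet.inter ((measurableSet_le measurable_gauge measurable_const).inter
      (measurableSet_le measurable_const measurable_snd))
  have hWmono : Monotone W := by
    intro j k hjk z hz
    have hjk' : (j : ℝ) ≤ k := by exact_mod_cast hjk
    refine ⟨hz.1, hz.2.1.trans (by exact_mod_cast Nat.add_le_add_left hjk n₀), ?_⟩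
    refine le_trans ?_ hz.2.2
    gcongr
  have hWunion : ⋃ k, W k = Sset N := by
    ext z
    simp only [mem_iUnion]
    refine ⟨fun ⟨k, hk⟩ => hk.1, fun hz => ?_⟩
    have hz' : 0 < z.2 := hz
    obtain ⟨k, hk⟩ := exists_nat_ge (max (logGauge γ z) (2 / z.2))
    have h1 := (le_max_left _ _).trans hk
    have h2 := (le_max_right _ _).trans hk
    rw [div_le_iff₀ hz'] at h2
    refine ⟨k, hz, ?_, ?_⟩
    · push_cast
      have : (0 : ℝ) ≤ n₀ := Nat.cast_nonneg _
      linarith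
    · rw [mul_one_div, div_le_iff₀ (by positivity)]
      linarith
  have hνS : ν (Sset N)ᶜ = 0 :=
    withDensity_absolutelyContinuous _ _ (ae_iff.1 (ae_mem_Sset ha))
  set T : ℕ → Set (Euc N × ℝ) := fun k => {z | ((n₀ + k : ℕ) : ℝ) < logGauge γ z} with hTdef
  have hTmeas : ∀ k, MeasurableSet (T k) := fun k =>
    measurableSet_lt measurable_const measurable_gauge
  have hTanti : Antitone T := by
    intro j k hjk z hz
    have hz' : ((n₀ + k : ℕ) : ℝ) < logGauge γ z := hz
    exact lt_of_le_of_lt (Nat.cast_le.2 (Nat.add_le_add_left hjk n₀)) hz'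
  have hTinter : ⋂ k, T k = ∅ := by
    refine eq_empty_of_forall_notMem fun z hz => ?_
    obtain ⟨k, hk⟩ := exists_nat_ge (logGauge γ z)
    have h1 : ((n₀ + k : ℕ) : ℝ) < logGauge γ z := mem_iInter.1 hz k
    push_cast at h1
    have : (0 : ℝ) ≤ n₀ := Nat.cast_nonneg _
    linarith
  have hstep : ∀ (Λ : ℝ) (k : ℕ), 0 < Λ → ∃ y z : ℝ, y ≤ B * Λ * z + B * decay p m q α Λ ∧ 0 ≤ z ∧
      z ≤ y ∧ ν (W k) ≤ ENNReal.ofReal y ∧ ENNReal.ofReal z ≤ ν (T k) := by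
    intro Λ k hΛ
    obtain ⟨y, z, h1, h2, h3, h4, h5⟩ := H (n₀ + k) (Nat.le_add_right _ _) (1 / ((k : ℝ) + 1)) Λ
      (by positivity) hΛ
    refine ⟨y, z, h1, h2, h3, ?_, h5.trans ?_⟩
    · rw [hν, withDensity_apply _ (hWmeas k)]; exact h4
    · rw [hν, withDensity_apply _ (hTmeas k)]
      have hn : (0 : ℝ) < (n₀ + k : ℕ) := by exact_mod_cast (by omega : 0 < n₀ + k)
      exact lintegral_mono_set fun z hz => lt_gauge_of_cut_lt_one hn hz.2
  have hfin : ν univ ≠ ∞ := by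
    have hΛ : 0 < 1 / (2 * B) := by positivity
    refine ne_top_of_le_ne_top (ENNReal.ofReal_ne_top (r := 2 * (B * decay p m q α (1 / (2 * B)))))
      (measure_le_of_forall_exhaustion hWmono hWunion hνS fun k => ?_)
    obtain ⟨y, z, h1, h2, h3, h4, -⟩ := hstep _ k hΛ
    refine h4.trans (ENNReal.ofReal_le_ofReal ?_)
    have : B * (1 / (2 * B)) = 1 / 2 := by field_simp
    rw [this] at h1
    linarith
  have : IsFiniteMeasure ν := ⟨lt_top_iff_ne_top.2 hfin⟩
  have hTlim : Tendsto (fun k => ν (T k)) atTop (𝓝 0) := by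
    have := tendsto_measure_iInter_atTop (μ := ν) (fun k => (hTmeas k).nullMeasurableSet) hTanti
      ⟨0, measure_ne_top _ _⟩
    rwa [hTinter, measure_empty] at this
  have hWlim : Tendsto (fun k => ν (W k)) atTop (𝓝 (ν univ)) := by
    have := tendsto_measure_iUnion_atTop (μ := ν) hWmono
    rw [hWunion] at this
    rwa [← measure_of_measure_compl_eq_zero hνS]
  have hdecay : ∀ Λ : ℝ, 0 < Λ → ν univ ≤ ENNReal.ofReal (B * decay p m q α Λ) := by
    intro Λ hΛ
    have hb : ∀ k, ν (W k) ≤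
        ENNReal.ofReal (B * Λ) * ν (T k) + ENNReal.ofReal (B * decay p m q α Λ) := by
      intro k
      obtain ⟨y, z, h1, h2, h3, h4, h5⟩ := hstep Λ k hΛ
      have hd := decay_nonneg (p := p) (m := m) (q := q) (α := α) hΛ
      calc ν (W k) ≤ ENNReal.ofReal (B * Λ * z + B * decay p m q α Λ) :=
            h4.trans (ENNReal.ofReal_le_ofReal h1)
        _ = ENNReal.ofReal (B * Λ) * ENNReal.ofReal z + ENNReal.ofReal (B * decay p m q α Λ) := by
            rw [ENNReal.ofReal_add (by positivity) (by positivity),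
              ENNReal.ofReal_mul (by positivity)]
        _ ≤ _ := by gcongr
    have hlim := (ENNReal.Tendsto.const_mul hTlim (a := ENNReal.ofReal (B * Λ))
      (Or.inr ENNReal.ofReal_ne_top)).add_const (ENNReal.ofReal (B * decay p m q α Λ))
    rw [mul_zero, zero_add] at hlim
    exact le_of_tendsto_of_tendsto' hWlim hlim hb
  have hzero : Tendsto (fun Λ => ENNReal.ofReal (B * decay p m q α Λ)) atTop (𝓝 0) := by
    have := ENNReal.tendsto_ofReal ((tendsto_decay P).const_mul B)
    rwa [mul_zero, ENNReal.ofReal_zero] at this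
  have := ge_of_tendsto hzero ((eventually_gt_atTop 0).mono hdecay)
  rw [hν, withDensity_apply _ MeasurableSet.univ, Measure.restrict_univ] at this
  exact le_antisymm this zero_le

end

/-- Corollary 1.12 (Euclidean specialization): `V ≡ 1` and a weighted volume
growth condition on balls. -/
theorem corollary_volume_growth
    (N : ℕ) (hN : 1 ≤ N) (p m q K : ℝ)
    (hp : 1 < p) (hm : 1 ≤ m) (hq : max (p + m - 2) 1 < q) (hK : 0 < K)
    (f : ℝ → ℝ) (a : Euc N → ℝ)
    (hf : ∀ s : ℝ, 0 ≤ s → 0 ≤ f s ∧ f s ≤ K)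
    (haLip : LocallyLipschitz a)
    (haPos : ∀ᵐ x ∂ (volume : Measure (Euc N)), 0 < a x)
    (C : ℝ) (hC : 0 < C)
    (hvol : ∃ R1 : ℝ, 1 < R1 ∧ ∀ R, R1 ≤ R →
      muA a (Metric.ball (0 : Euc N) R) ≤
        ENNReal.ofReal (C * R ^ (p / (q - p - m + 2)) *
          Real.log R ^ min (1 / (q - 1)) ((p + m - 2) / (q - p - m + 2))))
    (u : Euc N × ℝ → ℝ) (gu : Euc N × ℝ → Euc N) (ut : Euc N × ℝ → ℝ)
    (hu : IsWeakSol N p m q (fun _ => 1) f a u gu ut) :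
    ∀ᵐ z ∂ ((volume : Measure (Euc N × ℝ)).restrict (Sset N)), u z = 0 := by
  obtain ⟨α, s, P⟩ := exists_params hp hm hq
  have ha := haLip.continuous
  have hS := (isOpen_Sset N).measurableSet
  have hq1 : 1 < q := P.hq
  have hσ := P.hσ
  have hδ : 0 ≤ min (1 / (q - 1)) ((p + m - 2) / (q - p - m + 2)) :=
    le_min (div_nonneg zero_le_one (by linarith)) (div_nonneg (by linarith) hσ.le)
  have h0 := lintegral_rpow_eq_zero P hδ hK rfl ha hC hvol hf hu
  have hmeas : AEMeasurable (fun z => ENNReal.ofReal (u z ^ q)) (muS a) := by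
    have h := hu.locLip.continuousOn.aemeasurable (μ := muS a) hS
    rw [Measure.restrict_eq_self_of_ae_mem (ae_mem_Sset ha)] at h
    exact (h.pow_const q).ennreal_ofReal
  rw [lintegral_eq_zero_iff' hmeas] at h0
  filter_upwards [(absolutelyContinuous_muS ha haPos).ae_le h0, ae_restrict_mem hS] with z hz hzS
  have h1 := hu.nonneg z hzS
  have h2 : u z ^ q ≤ 0 := ENNReal.ofReal_eq_zero.1 hz
  exact (rpow_eq_zero h1 (by linarith)).1 (le_antisymm h2 (rpow_nonneg h1 q))

end
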